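/- arXiv:1511.06895 — 2 statements merged into one kernel-verified Lean document; each statement's English description precedes it below -/
import Mathlib

section
/- Let Ω ⊂ ℝ be a bounded closed interval and let M : Ω × [0,∞) → ℝ be such that (x,y) ↦ M(x,√y) is C² on Ω × [0,∞) and such that for all x ∈ Ω and all y > 0 the 2×2 matrix [[M_xx(x,y) + M_y(x,y)/y, M_xy(x,y)], [M_xy(x,y), M_yy(x,y)]] is negative semidefinite. Then for every smooth bounded function f : ℝⁿ → Ω with bounded derivatives, ∫_{ℝⁿ} M(f(x), ‖∇f(x)‖) dγ(x) ≤ M(∫_{ℝⁿ} f dγ, 0), where γ is the standard Gaussian measure on ℝⁿ. -/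
open MeasureTheory Real

/-- Negative semidefiniteness of a real matrix. -/
def Matrix.NegSemidef' {n : Type*} [Fintype n] (A : Matrix n n ℝ) : Prop :=
  (-A).PosSemidef

/-- Partial derivative `M_x`. -/
noncomputable def Mx (M : ℝ → ℝ → ℝ) (x y : ℝ) : ℝ := deriv (fun s => M s y) x

/-- Partial derivative `M_y`. -/
noncomputable def My (M : ℝ → ℝ → ℝ) (x y : ℝ) : ℝ := deriv (fun s => M x s) y

/-- Partial derivative `M_xx`. -/
noncomputable def Mxx (M : ℝ → ℝ → ℝ) (x y : ℝ) : ℝ := deriv (fun s => Mx M s y) x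

/-- Partial derivative `M_xy`. -/
noncomputable def Mxy (M : ℝ → ℝ → ℝ) (x y : ℝ) : ℝ := deriv (fun s => Mx M x s) y

/-- Partial derivative `M_yy`. -/
noncomputable def Myy (M : ℝ → ℝ → ℝ) (x y : ℝ) : ℝ := deriv (fun s => My M x s) y

/-- The matrix `[[M_xx + M_y/y, M_xy], [M_xy, M_yy]]`. -/
noncomputable def Mmat (M : ℝ → ℝ → ℝ) (x y : ℝ) : Matrix (Fin 2) (Fin 2) ℝ :=
  !![Mxx M x y + My M x y / y, Mxy M x y; Mxy M x y, Myy M x y]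


/-- The density of the standard Gaussian measure on `ℝⁿ`. -/
noncomputable def gaussDensity (n : ℕ) (x : EuclideanSpace ℝ (Fin n)) : ℝ :=
  (2 * π) ^ (-(n : ℝ) / 2) * Real.exp (-‖x‖ ^ 2 / 2)

/-- The standard Gaussian measure on `ℝⁿ`. -/
noncomputable def gaussMeasure (n : ℕ) : Measure (EuclideanSpace ℝ (Fin n)) :=
  volume.withDensity (fun x => ENNReal.ofReal (gaussDensity n x))

section Gauss

variable {n : ℕ}

lemma gaussDensity_nonneg (x : EuclideanSpace ℝ (Fin n)) : 0 ≤ gaussDensity n x := by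
  unfold gaussDensity; positivity

lemma continuous_gaussDensity : Continuous (gaussDensity n) := by
  unfold gaussDensity; fun_prop

lemma integral_gaussMeasure (g : EuclideanSpace ℝ (Fin n) → ℝ) :
    ∫ x, g x ∂gaussMeasure n = ∫ x, gaussDensity n x * g x := by
  unfold gaussMeasure
  rw [integral_withDensity_eq_integral_toReal_smul
    (by have := continuous_gaussDensity (n := n); fun_prop) (by simp)]
  simp [ENNReal.toReal_ofReal (gaussDensity_nonneg _)]

lemma integrable_gaussMeasure_iff {g : EuclideanSpace ℝ (Fin n) → ℝ} :
    Integrable g (gaussMeasure n) ↔ Integrable (fun x => gaussDensity n x * g x) := by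
  unfold gaussMeasure
  rw [integrable_withDensity_iff_integrable_smul'
    (by have := continuous_gaussDensity (n := n); fun_prop) (by simp)]
  simp [ENNReal.toReal_ofReal (gaussDensity_nonneg _)]

lemma integral_gaussDensity : ∫ x, gaussDensity n x = 1 := by
  unfold gaussDensity
  have h := GaussianFourier.integral_rexp_neg_mul_sq_norm
    (V := EuclideanSpace ℝ (Fin n)) (b := 1 / 2) (by norm_num)
  rw [integral_const_mul]
  have h2 : (fun x : EuclideanSpace ℝ (Fin n) => Real.exp (-‖x‖ ^ 2 / 2))
      = fun x => Real.exp (-(1 / 2) * ‖x‖ ^ 2) := by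
    ext x; ring_nf
  rw [h2, h, show π / (1 / 2) = 2 * π by ring, finrank_euclideanSpace_fin,
    ← Real.rpow_add (by positivity)]
  ring_nf
  simp

instance : IsProbabilityMeasure (gaussMeasure n) := by
  constructor
  have hi : Integrable (gaussDensity n) := by
    by_contra h
    have := integral_undef h
    rw [integral_gaussDensity] at this
    exact one_ne_zero this
  rw [gaussMeasure, withDensity_apply _ MeasurableSet.univ, Measure.restrict_univ,
    ← ofReal_integral_eq_lintegral_ofReal hi (ae_of_all _ gaussDensity_nonneg),
    integral_gaussDensity, ENNReal.ofReal_one]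

lemma integrable_norm_gaussMeasure : Integrable (fun x => ‖x‖) (gaussMeasure n) := by
  rw [integrable_gaussMeasure_iff]
  have h := GaussianFourier.integral_rexp_neg_mul_sq_norm
    (V := EuclideanSpace ℝ (Fin n)) (b := 1 / 4) (by norm_num)
  have hi : Integrable (fun x : EuclideanSpace ℝ (Fin n) => Real.exp (-(1 / 4) * ‖x‖ ^ 2)) := by
    by_contra h'
    rw [integral_undef h'] at h
    have : 0 < (π / (1 / 4)) ^ (Module.finrank ℝ (EuclideanSpace ℝ (Fin n)) / 2 : ℝ) := by
      positivity
    exact this.ne h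
  refine (hi.const_mul ((2 * π) ^ (-(n : ℝ) / 2))).mono'
    (continuous_gaussDensity.mul continuous_norm).aestronglyMeasurable (ae_of_all _ fun x => ?_)
  rw [Real.norm_of_nonneg (mul_nonneg (gaussDensity_nonneg x) (norm_nonneg x)), gaussDensity,
    mul_assoc]
  gcongr
  have h1 : ‖x‖ ≤ Real.exp (‖x‖ ^ 2 / 4) := by
    have := Real.add_one_le_exp (‖x‖ ^ 2 / 4)
    nlinarith [sq_nonneg (1 - ‖x‖ / 2)]
  calc Real.exp (-‖x‖ ^ 2 / 2) * ‖x‖ ≤ Real.exp (-‖x‖ ^ 2 / 2) * Real.exp (‖x‖ ^ 2 / 4) := by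
        gcongr
    _ = _ := by rw [← Real.exp_add]; ring_nf

lemma abs_coord_le_norm (x : EuclideanSpace ℝ (Fin n)) (j : Fin n) : |x j| ≤ ‖x‖ := by
  simpa using PiLp.norm_apply_le x j

lemma integrable_coord_mul {K : EuclideanSpace ℝ (Fin n) → ℝ} (hK : Continuous K) {C : ℝ}
    (hC : ∀ x, |K x| ≤ C) (j : Fin n) : Integrable (fun x => x j * K x) (gaussMeasure n) := by
  refine (integrable_norm_gaussMeasure.const_mul C).mono'
    (by fun_prop) (ae_of_all _ fun x => ?_)
  rw [Real.norm_eq_abs, abs_mul, mul_comm]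
  exact mul_le_mul (hC x) (abs_coord_le_norm x j) (abs_nonneg _) ((abs_nonneg _).trans (hC x))

lemma integrable_of_bounded {K : EuclideanSpace ℝ (Fin n) → ℝ} (hK : Continuous K) {C : ℝ}
    (hC : ∀ x, |K x| ≤ C) : Integrable K (gaussMeasure n) :=
  (integrable_const C).mono' hK.aestronglyMeasurable (ae_of_all _ hC)

/-- Gaussian integration by parts (Stein's identity) in a coordinate direction. -/
lemma integral_coord_mul_gaussMeasure {K K' : EuclideanSpace ℝ (Fin n) → ℝ} (hK : Continuous K)
    {C : ℝ} (hC : ∀ x, |K x| ≤ C) (hK' : Continuous K') {C' : ℝ} (hC' : ∀ x, |K' x| ≤ C')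
    (j : Fin n) (hd : ∀ x, HasLineDerivAt ℝ K (K' x) x (EuclideanSpace.single j 1)) :
    ∫ x, x j * K x ∂gaussMeasure n = ∫ x, K' x ∂gaussMeasure n := by
  have hρ : ∀ x, HasLineDerivAt ℝ (gaussDensity n) (-(x j * gaussDensity n x)) x
      (EuclideanSpace.single j 1) := by
    intro x
    have h1 : HasFDerivAt (fun x : EuclideanSpace ℝ (Fin n) => ‖x‖ ^ 2) (2 • innerSL ℝ x) x :=
      (hasStrictFDerivAt_norm_sq x).hasFDerivAt
    have h2 := (((h1.hasLineDerivAt (EuclideanSpace.single j 1)).fun_neg.div_const 2).exp.const_mul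
      ((2 * π) ^ (-(n : ℝ) / 2)))
    simp only [zero_smul, add_zero] at h2
    rw [HasLineDerivAt]
    convert! h2 using 1
    simp [gaussDensity, EuclideanSpace.inner_single_right]
    ring
  have key := integral_bilinear_hasLineDerivAt_right_eq_neg_left_of_integrable
    (μ := (volume : Measure (EuclideanSpace ℝ (Fin n)))) (f := K) (f' := K') (g := gaussDensity n)
    (g' := fun x => -(x j * gaussDensity n x)) (v := EuclideanSpace.single j 1)
    (B := ContinuousLinearMap.mul ℝ ℝ) ?_ ?_ ?_ (fun x _ => hd x) (fun x _ => hρ x)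
  · simp only [ContinuousLinearMap.mul_apply', mul_neg, integral_neg, neg_inj] at key
    rw [integral_gaussMeasure, integral_gaussMeasure]
    refine Eq.trans ?_ (key.trans ?_)
    · congr 1; ext x; ring
    · congr 1; ext x; ring
  · have := integrable_gaussMeasure_iff.1 (integrable_of_bounded hK' hC')
    simpa [mul_comm] using this
  · have := (integrable_gaussMeasure_iff.1 (integrable_coord_mul hK hC j)).neg
    refine this.congr (ae_of_all _ fun x => ?_)
    simp; ring
  · have := integrable_gaussMeasure_iff.1 (integrable_of_bounded hK hC)
    simpa [mul_comm] using this

end Gauss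

section BoundedContinuous

/-- Bounded continuous real functions. -/
def IsBC {X : Type*} [TopologicalSpace X] (q : X → ℝ) : Prop :=
  Continuous q ∧ ∃ C, ∀ p, |q p| ≤ C

variable {X Y : Type*} [TopologicalSpace X] [TopologicalSpace Y] {q r : X → ℝ}

lemma IsBC.const (c : ℝ) : IsBC (fun _ : X => c) := ⟨continuous_const, |c|, fun _ => le_rfl⟩

lemma IsBC.add (hq : IsBC q) (hr : IsBC r) : IsBC (fun p => q p + r p) := by
  obtain ⟨hq, C, hC⟩ := hq
  obtain ⟨hr, D, hD⟩ := hr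
  exact ⟨hq.add hr, C + D, fun p => (abs_add_le _ _).trans (add_le_add (hC p) (hD p))⟩

lemma IsBC.mul (hq : IsBC q) (hr : IsBC r) : IsBC (fun p => q p * r p) := by
  obtain ⟨hq, C, hC⟩ := hq
  obtain ⟨hr, D, hD⟩ := hr
  refine ⟨hq.mul hr, C * D, fun p => ?_⟩
  rw [abs_mul]
  exact mul_le_mul (hC p) (hD p) (abs_nonneg _) ((abs_nonneg _).trans (hC p))

lemma IsBC.sq (hq : IsBC q) : IsBC (fun p => q p ^ 2) := by
  simpa only [pow_two] using hq.mul hq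

lemma IsBC.sum {ι : Type*} (s : Finset ι) {q : ι → X → ℝ} (hq : ∀ i, IsBC (q i)) :
    IsBC (fun p => ∑ i ∈ s, q i p) := by
  classical
  induction s using Finset.induction_on with
  | empty => simpa using IsBC.const 0
  | insert i s hi ih => simpa [Finset.sum_insert hi] using (hq i).add ih

lemma IsBC.comp (hq : IsBC q) {g : Y → X} (hg : Continuous g) : IsBC (fun y => q (g y)) := by
  obtain ⟨hq, C, hC⟩ := hq
  exact ⟨hq.comp hg, C, fun y => hC _⟩

lemma IsBC.sin {g : X → ℝ} (hg : Continuous g) : IsBC (fun p => Real.sin (g p)) :=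
  ⟨Real.continuous_sin.comp hg, 1, fun _ => Real.abs_sin_le_one _⟩

lemma IsBC.cos {g : X → ℝ} (hg : Continuous g) : IsBC (fun p => Real.cos (g p)) :=
  ⟨Real.continuous_cos.comp hg, 1, fun _ => Real.abs_cos_le_one _⟩

end BoundedContinuous

section Semigroup

variable {n : ℕ}

lemma IsBC.integrable {K : EuclideanSpace ℝ (Fin n) → ℝ} (hK : IsBC K) :
    Integrable K (gaussMeasure n) :=
  hK.2.elim fun _ hC => integrable_of_bounded hK.1 hC

lemma IsBC.integrable_coord_mul {K : EuclideanSpace ℝ (Fin n) → ℝ} (hK : IsBC K) (j : Fin n) :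
    Integrable (fun x => x j * K x) (gaussMeasure n) :=
  hK.2.elim fun _ hC => _root_.integrable_coord_mul hK.1 hC j

lemma IsBC.integral_coord_mul {K K' : EuclideanSpace ℝ (Fin n) → ℝ} (hK : IsBC K)
    (hK' : IsBC K') (j : Fin n)
    (hd : ∀ x, HasLineDerivAt ℝ K (K' x) x (EuclideanSpace.single j 1)) :
    ∫ x, x j * K x ∂gaussMeasure n = ∫ x, K' x ∂gaussMeasure n :=
  hK.2.elim fun _ hC => hK'.2.elim fun _ hC' =>
    integral_coord_mul_gaussMeasure hK.1 hC hK'.1 hC' j hd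

/-- Smooth functions that are bounded together with all their derivatives. -/
def BoundedSmooth (h : EuclideanSpace ℝ (Fin n) → ℝ) : Prop :=
  ContDiff ℝ (⊤ : ℕ∞) h ∧ ∀ i : ℕ, ∃ C : ℝ, ∀ x, ‖iteratedFDeriv ℝ i h x‖ ≤ C

/-- The partial derivative in the `j`-th coordinate. -/
noncomputable def partialD (j : Fin n) (h : EuclideanSpace ℝ (Fin n) → ℝ) :
    EuclideanSpace ℝ (Fin n) → ℝ :=
  fun x => fderiv ℝ h x (EuclideanSpace.single j 1)

variable {h : EuclideanSpace ℝ (Fin n) → ℝ}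

lemma BoundedSmooth.partialD (hh : BoundedSmooth h) (j : Fin n) : BoundedSmooth (partialD j h) := by
  have h1 : ContDiff ℝ (⊤ : ℕ∞) (fderiv ℝ h) := hh.1.fderiv_right (by simp)
  refine ⟨h1.clm_apply contDiff_const, fun i => ?_⟩
  obtain ⟨C, hC⟩ := hh.2 (i + 1)
  refine ⟨‖(EuclideanSpace.single j 1 : EuclideanSpace ℝ (Fin n))‖ * C, fun x => ?_⟩
  refine (norm_iteratedFDeriv_clm_apply_const (h1.contDiffAt (x := x)) (n := i)
    (by exact_mod_cast le_top)).trans ?_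
  rw [norm_iteratedFDeriv_fderiv]
  exact mul_le_mul_of_nonneg_left (hC x) (norm_nonneg _)

lemma BoundedSmooth.hasFDerivAt (hh : BoundedSmooth h) (x : EuclideanSpace ℝ (Fin n)) :
    HasFDerivAt h (fderiv ℝ h x) x :=
  (hh.1.differentiable (by simp)).differentiableAt.hasFDerivAt

lemma BoundedSmooth.isBC (hh : BoundedSmooth h) : IsBC h := by
  obtain ⟨C, hC⟩ := hh.2 0
  exact ⟨hh.1.continuous, C, fun x => by simpa using hC x⟩

lemma BoundedSmooth.fderiv_le (hh : BoundedSmooth h) : ∃ C, ∀ x, ‖fderiv ℝ h x‖ ≤ C := by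
  obtain ⟨C, hC⟩ := hh.2 1
  refine ⟨C, fun x => ?_⟩
  have := hC x
  rwa [← zero_add 1, ← norm_iteratedFDeriv_fderiv, norm_iteratedFDeriv_zero] at this

lemma BoundedSmooth.continuous_fderiv (hh : BoundedSmooth h) : Continuous (fderiv ℝ h) :=
  hh.1.continuous_fderiv (by simp)

lemma fderiv_apply_eq_sum (x v : EuclideanSpace ℝ (Fin n)) :
    fderiv ℝ h x v = ∑ j, v j * partialD j h x := by
  conv_lhs => rw [← (EuclideanSpace.basisFun (Fin n) ℝ).sum_repr v]
  simp [partialD]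

/-- The Ornstein-Uhlenbeck average `∫ h (sin θ • w + cos θ • z) dγ(z)`, as a function of
`p = (θ, w)`. -/
noncomputable def ouAvg (h : EuclideanSpace ℝ (Fin n) → ℝ) (p : ℝ × EuclideanSpace ℝ (Fin n)) :
    ℝ :=
  ∫ z, h (Real.sin p.1 • p.2 + Real.cos p.1 • z) ∂gaussMeasure n

lemma isBC_ouAvg (hh : IsBC h) : IsBC (ouAvg h) := by
  obtain ⟨hc, C, hC⟩ := hh
  constructor
  · refine continuous_of_dominated (bound := fun _ => C) (fun p => ?_)
      (fun p => ae_of_all _ fun z => hC _) (integrable_const _) (ae_of_all _ fun z => ?_)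
    · exact (by fun_prop : Continuous _).aestronglyMeasurable
    · fun_prop
  · refine ⟨C, fun p => ?_⟩
    have := norm_integral_le_of_norm_le_const (μ := gaussMeasure n)
      (f := fun z => h (Real.sin p.1 • p.2 + Real.cos p.1 • z)) (ae_of_all _ fun z => hC (Real.sin p.1 • p.2 + Real.cos p.1 • z))
    simpa [ouAvg] using this

lemma hasLineDerivAt_ouAvg (hh : BoundedSmooth h) (θ : ℝ) (w : EuclideanSpace ℝ (Fin n))
    (j : Fin n) :
    HasLineDerivAt ℝ (fun w => ouAvg h (θ, w)) (Real.sin θ * ouAvg (partialD j h) (θ, w)) w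
      (EuclideanSpace.single j 1) := by
  obtain ⟨C, hC⟩ := (hh.partialD j).isBC.2
  have hcont := hh.1.continuous
  have hpc := (hh.partialD j).isBC.1
  have key := hasDerivAt_integral_of_dominated_loc_of_deriv_le (μ := gaussMeasure n) (𝕜 := ℝ)
    (F := fun t z => h (Real.sin θ • (w + t • EuclideanSpace.single j 1) + Real.cos θ • z))
    (F' := fun t z => Real.sin θ * partialD j h
      (Real.sin θ • (w + t • EuclideanSpace.single j 1) + Real.cos θ • z))
    (x₀ := 0) (s := Set.univ) (bound := fun _ => |Real.sin θ| * C) Filter.univ_mem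
    (.of_forall fun t => (by fun_prop : Continuous _).aestronglyMeasurable)
    (hh.isBC.comp (by fun_prop)).integrable
    (by fun_prop : Continuous _).aestronglyMeasurable
    (ae_of_all _ fun z t _ => by
      rw [Real.norm_eq_abs, abs_mul]; exact mul_le_mul_of_nonneg_left (hC _) (abs_nonneg _))
    (integrable_const _)
    (ae_of_all _ fun z t _ => ?_)
  · rw [HasLineDerivAt]
    convert! key.2 using 1
    simp [ouAvg, integral_const_mul]
  · have h1 : HasDerivAt (fun t : ℝ => Real.sin θ • (w + t • EuclideanSpace.single j 1)
        + Real.cos θ • z) (Real.sin θ • (EuclideanSpace.single j 1 : EuclideanSpace ℝ (Fin n)))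
        t := by
      simpa using ((((hasDerivAt_id t).smul_const
        (EuclideanSpace.single j 1 : EuclideanSpace ℝ (Fin n))).const_add w).const_smul
          (Real.sin θ)).add_const (Real.cos θ • z)
    have := (hh.hasFDerivAt _).comp_hasDerivAt t h1
    simpa [partialD, Function.comp_def] using this

lemma hasDerivAt_ouAvg (hh : BoundedSmooth h) (θ : ℝ) (w : EuclideanSpace ℝ (Fin n)) :
    HasDerivAt (fun θ => ouAvg h (θ, w))
      (Real.cos θ * ∑ j, (w j * ouAvg (partialD j h) (θ, w)
        - Real.sin θ * ouAvg (partialD j (partialD j h)) (θ, w))) θ := by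
  obtain ⟨C, hC⟩ := hh.fderiv_le
  have hcont := hh.1.continuous
  have hfc := hh.continuous_fderiv
  have hC0 : 0 ≤ C := (norm_nonneg _).trans (hC 0)
  have key := hasDerivAt_integral_of_dominated_loc_of_deriv_le (μ := gaussMeasure n) (𝕜 := ℝ)
    (F := fun t z => h (Real.sin t • w + Real.cos t • z))
    (F' := fun t z => fderiv ℝ h (Real.sin t • w + Real.cos t • z)
      (Real.cos t • w - Real.sin t • z))
    (x₀ := θ) (s := Set.univ) (bound := fun z => C * (‖w‖ + ‖z‖)) Filter.univ_mem
    (.of_forall fun t => (by fun_prop : Continuous _).aestronglyMeasurable)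
    (hh.isBC.comp (by fun_prop)).integrable
    (by fun_prop : Continuous _).aestronglyMeasurable
    (ae_of_all _ fun z t _ => by
      refine (ContinuousLinearMap.le_opNorm _ _).trans ?_
      refine mul_le_mul (hC _) ((norm_sub_le _ _).trans ?_) (norm_nonneg _) hC0
      rw [norm_smul, norm_smul]
      exact add_le_add (mul_le_of_le_one_left (norm_nonneg _) (Real.abs_cos_le_one t))
        (mul_le_of_le_one_left (norm_nonneg _) (Real.abs_sin_le_one t)))
    (((integrable_const _).add integrable_norm_gaussMeasure).const_mul C)
    (ae_of_all _ fun z t _ => ?_)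
  · convert! key.2 using 1
    have hb : ∀ j, IsBC fun z => partialD j h (Real.sin θ • w + Real.cos θ • z) := fun j =>
      (hh.partialD j).isBC.comp (by fun_prop)
    have hb2 : ∀ j, IsBC fun z => Real.cos θ *
        partialD j (partialD j h) (Real.sin θ • w + Real.cos θ • z) := fun j =>
      (IsBC.const _).mul (((hh.partialD j).partialD j).isBC.comp (by fun_prop))
    have hstein : ∀ j, ∫ z, z j * partialD j h (Real.sin θ • w + Real.cos θ • z) ∂gaussMeasure n
        = Real.cos θ * ouAvg (partialD j (partialD j h)) (θ, w) := by
      intro j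
      rw [(hb j).integral_coord_mul (hb2 j) j, integral_const_mul, ouAvg]
      intro z
      have h1 : HasDerivAt (fun t : ℝ => Real.sin θ • w
          + Real.cos θ • (z + t • EuclideanSpace.single j 1))
          (Real.cos θ • (EuclideanSpace.single j 1 : EuclideanSpace ℝ (Fin n))) 0 := by
        simpa using ((((hasDerivAt_id (0 : ℝ)).smul_const
          (EuclideanSpace.single j 1 : EuclideanSpace ℝ (Fin n))).const_add z).const_smul
            (Real.cos θ)).const_add (Real.sin θ • w)
      have := ((hh.partialD j).hasFDerivAt _).comp_hasDerivAt 0 h1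
      simpa [HasLineDerivAt, partialD, Function.comp_def] using this
    have hsum : ∀ z : EuclideanSpace ℝ (Fin n), fderiv ℝ h (Real.sin θ • w + Real.cos θ • z)
        (Real.cos θ • w - Real.sin θ • z)
        = ∑ j, (Real.cos θ * w j * partialD j h (Real.sin θ • w + Real.cos θ • z)
          - Real.sin θ * (z j * partialD j h (Real.sin θ • w + Real.cos θ • z))) := by
      intro z
      rw [fderiv_apply_eq_sum]
      refine Finset.sum_congr rfl fun j _ => ?_
      simp; ring
    simp_rw [hsum]
    rw [integral_finsetSum, Finset.mul_sum]
    · refine Finset.sum_congr rfl fun j _ => ?_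
      rw [integral_sub ((hb j).integrable.const_mul _)
        (((hb j).integrable_coord_mul j).const_mul _), integral_const_mul, integral_const_mul,
        hstein]
      simp only [ouAvg]
      ring
    · exact fun j _ => ((hb j).integrable.const_mul _).sub
        (((hb j).integrable_coord_mul j).const_mul _)
  · have h1 : HasDerivAt (fun t : ℝ => Real.sin t • w + Real.cos t • z)
        (Real.cos t • w - Real.sin t • z) t := by
      simpa [sub_eq_add_neg] using
        ((Real.hasDerivAt_sin t).smul_const w).fun_add ((Real.hasDerivAt_cos t).smul_const z)
    exact (hh.hasFDerivAt _).comp_hasDerivAt t h1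

end Semigroup

section ChainRule

/-- Chain rule for a function of two real variables along a curve. -/
lemma hasDerivAt_comp_pair {g : ℝ × ℝ → ℝ} {X Y : ℝ → ℝ} {X' Y' t : ℝ}
    (hg : DifferentiableAt ℝ g (X t, Y t)) (hX : HasDerivAt X X' t) (hY : HasDerivAt Y Y' t) :
    HasDerivAt (fun t => g (X t, Y t))
      (fderiv ℝ g (X t, Y t) (1, 0) * X' + fderiv ℝ g (X t, Y t) (0, 1) * Y') t := by
  have h := hg.hasFDerivAt.comp_hasDerivAt t (hX.prodMk hY)
  convert! h using 1
  have : (X', Y') = X' • ((1, 0) : ℝ × ℝ) + Y' • ((0, 1) : ℝ × ℝ) := by simp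
  rw [this, map_add, map_smul, map_smul, smul_eq_mul, smul_eq_mul]
  ring

/-- First partial derivative of a function on `ℝ × ℝ`. -/
noncomputable def pderivFst (g : ℝ × ℝ → ℝ) (p : ℝ × ℝ) : ℝ := fderiv ℝ g p (1, 0)

/-- Second partial derivative of a function on `ℝ × ℝ`. -/
noncomputable def pderivSnd (g : ℝ × ℝ → ℝ) (p : ℝ × ℝ) : ℝ := fderiv ℝ g p (0, 1)

variable {g : ℝ × ℝ → ℝ} {U : Set (ℝ × ℝ)}

lemma contDiffOn_fderiv_apply {k m : WithTop ℕ∞} (hU : IsOpen U) (hg : ContDiffOn ℝ m g U)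
    (hkm : k + 1 ≤ m) (v : ℝ × ℝ) : ContDiffOn ℝ k (fun p => fderiv ℝ g p v) U :=
  (hg.fderiv_of_isOpen hU hkm).clm_apply contDiffOn_const

lemma pderivFst_pderivSnd (hU : IsOpen U) (hg : ContDiffOn ℝ 2 g U) {p : ℝ × ℝ} (hp : p ∈ U) :
    pderivFst (pderivSnd g) p = pderivSnd (pderivFst g) p := by
  have h1 : ContDiffAt ℝ 2 g p := hg.contDiffAt (hU.mem_nhds hp)
  have h2 : DifferentiableAt ℝ (fderiv ℝ g) p :=
    (h1.fderiv_right (m := 1) (by norm_num)).differentiableAt (by norm_num)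
  have h3 := h1.isSymmSndFDerivAt (by simp)
  have h4 : ∀ v w : ℝ × ℝ, fderiv ℝ (fun q => fderiv ℝ g q v) p w
      = fderiv ℝ (fderiv ℝ g) p w v := by
    intro v w
    rw [fderiv_clm_apply h2 (differentiableAt_const v)]
    simp
  unfold pderivFst pderivSnd
  rw [h4, h4]
  exact h3.eq _ _

end ChainRule

section Monotonicity

variable {n : ℕ}

lemma hasDerivAt_integral_of_linear_growth {Φ : ℝ × EuclideanSpace ℝ (Fin n) → ℝ} (hΦ : IsBC Φ)
    {P Q : Fin n → ℝ × EuclideanSpace ℝ (Fin n) → ℝ} (hP : ∀ j, IsBC (P j))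
    (hQ : ∀ j, IsBC (Q j))
    (hd : ∀ θ w, HasDerivAt (fun θ => Φ (θ, w)) (∑ j, (w j * P j (θ, w) + Q j (θ, w))) θ) (θ : ℝ) :
    HasDerivAt (fun θ => ∫ w, Φ (θ, w) ∂gaussMeasure n)
      (∑ j, ((∫ w, w j * P j (θ, w) ∂gaussMeasure n) + ∫ w, Q j (θ, w) ∂gaussMeasure n)) θ := by
  choose hPc C hC using hP
  choose hQc D hD using hQ
  have hPi : ∀ j, Integrable (fun w => w j * P j (θ, w)) (gaussMeasure n) := fun j =>
    integrable_coord_mul (by have := hPc j; fun_prop) (fun w => hC j (θ, w)) j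
  have hQi : ∀ j, Integrable (fun w => Q j (θ, w)) (gaussMeasure n) := fun j =>
    integrable_of_bounded (by have := hQc j; fun_prop) (fun w => hD j (θ, w))
  have key := hasDerivAt_integral_of_dominated_loc_of_deriv_le (μ := gaussMeasure n) (𝕜 := ℝ)
    (F := fun t w => Φ (t, w)) (F' := fun t w => ∑ j, (w j * P j (t, w) + Q j (t, w)))
    (x₀ := θ) (s := Set.univ) (bound := fun w => ∑ j, (C j * ‖w‖ + D j)) Filter.univ_mem
    (.of_forall fun t => (hΦ.comp (by fun_prop)).1.aestronglyMeasurable)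
    (hΦ.comp (by fun_prop)).integrable
    (by fun_prop : Continuous _).aestronglyMeasurable
    (ae_of_all _ fun w t _ => by
      refine (norm_sum_le _ _).trans (Finset.sum_le_sum fun j _ => ?_)
      rw [Real.norm_eq_abs]
      refine (abs_add_le _ _).trans (add_le_add ?_ (hD j _))
      rw [abs_mul, mul_comm]
      exact mul_le_mul (hC j _) (abs_coord_le_norm w j) (abs_nonneg _)
        ((abs_nonneg _).trans (hC j (t, w))))
    (integrable_finsetSum _ fun j _ =>
      (integrable_norm_gaussMeasure.const_mul _).add (integrable_const _))
    (ae_of_all _ fun w t _ => hd t w)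
  convert! key.2 using 1
  rw [integral_finsetSum _ fun j _ => (hPi j).fun_add (hQi j)]
  exact Finset.sum_congr rfl fun j _ => (integral_add (hPi j) (hQi j)).symm

lemma ouAvg_mem_Icc {f : EuclideanSpace ℝ (Fin n) → ℝ} (hf : IsBC f) {a b : ℝ}
    (hab : ∀ x, f x ∈ Set.Icc a b) (p : ℝ × EuclideanSpace ℝ (Fin n)) :
    ouAvg f p ∈ Set.Icc a b := by
  have hi : Integrable (fun z => f (Real.sin p.1 • p.2 + Real.cos p.1 • z)) (gaussMeasure n) :=
    (hf.comp (by fun_prop)).integrable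
  constructor
  · simpa [ouAvg] using integral_mono (integrable_const a) hi fun z => (hab _).1
  · simpa [ouAvg] using integral_mono hi (integrable_const b) fun z => (hab _).2

/-- The Gaussian inequality away from the boundary of the domain of `N`. -/
theorem integral_le_of_interior {a b a' b' ε : ℝ} (ha : a < a') (hb : b' < b) (hε : 0 < ε)
    {N : ℝ × ℝ → ℝ} (hN : ContDiffOn ℝ 2 N (Set.Ioo a b ×ˢ Set.Ioi 0))
    (hcond : ∀ p ∈ Set.Ioo a b ×ˢ Set.Ioi 0, ∀ α v r : ℝ, v ^ 2 ≤ 4 * p.2 * r →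
      pderivFst (pderivFst N) p * α ^ 2 + 2 * pderivSnd (pderivFst N) p * α * v
        + pderivSnd (pderivSnd N) p * v ^ 2 + 2 * pderivSnd N p * (α ^ 2 + r) ≤ 0)
    {f : EuclideanSpace ℝ (Fin n) → ℝ} (hf : BoundedSmooth f) (hfab : ∀ x, f x ∈ Set.Icc a' b') :
    ∫ x, N (f x, ∑ j, partialD j f x ^ 2 + ε) ∂gaussMeasure n
      ≤ N (∫ x, f x ∂gaussMeasure n, ε) := by
  set U : Set (ℝ × ℝ) := Set.Ioo a b ×ˢ Set.Ioi 0 with hUdef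
  have hU : IsOpen U := isOpen_Ioo.prod isOpen_Ioi
  have hN1 : ContDiffOn ℝ 1 (pderivFst N) U := contDiffOn_fderiv_apply hU hN (by norm_num) _
  have hN2 : ContDiffOn ℝ 1 (pderivSnd N) U := contDiffOn_fderiv_apply hU hN (by norm_num) _
  have hN11 : ContDiffOn ℝ 0 (pderivFst (pderivFst N)) U :=
    contDiffOn_fderiv_apply hU hN1 (by norm_num) _
  have hN12 : ContDiffOn ℝ 0 (pderivSnd (pderivFst N)) U :=
    contDiffOn_fderiv_apply hU hN1 (by norm_num) _
  have hN22 : ContDiffOn ℝ 0 (pderivSnd (pderivSnd N)) U :=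
    contDiffOn_fderiv_apply hU hN2 (by norm_num) _
  have hf1 : ∀ i, BoundedSmooth (partialD i f) := fun i => hf.partialD i
  have hf2 : ∀ i j, BoundedSmooth (partialD j (partialD i f)) := fun i j => (hf1 i).partialD j
  have hf3 : ∀ i j, BoundedSmooth (partialD j (partialD j (partialD i f))) :=
    fun i j => (hf2 i j).partialD j
  set A0 := ouAvg f with hA0
  set A1 : Fin n → ℝ × EuclideanSpace ℝ (Fin n) → ℝ := fun i => ouAvg (partialD i f) with hA1
  set A2 : Fin n → Fin n → ℝ × EuclideanSpace ℝ (Fin n) → ℝ :=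
    fun i j => ouAvg (partialD j (partialD i f)) with hA2
  set A3 : Fin n → Fin n → ℝ × EuclideanSpace ℝ (Fin n) → ℝ :=
    fun i j => ouAvg (partialD j (partialD j (partialD i f))) with hA3
  have bA0 : IsBC A0 := isBC_ouAvg hf.isBC
  have bA1 : ∀ i, IsBC (A1 i) := fun i => isBC_ouAvg (hf1 i).isBC
  have bA2 : ∀ i j, IsBC (A2 i j) := fun i j => isBC_ouAvg (hf2 i j).isBC
  have bA3 : ∀ i j, IsBC (A3 i j) := fun i j => isBC_ouAvg (hf3 i j).isBC
  have bs : IsBC fun p : ℝ × EuclideanSpace ℝ (Fin n) => Real.sin p.1 := IsBC.sin continuous_fst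
  have bc : IsBC fun p : ℝ × EuclideanSpace ℝ (Fin n) => Real.cos p.1 := IsBC.cos continuous_fst
  set u : ℝ × EuclideanSpace ℝ (Fin n) → ℝ :=
    fun p => Real.sin p.1 ^ 2 * ∑ i, A1 i p ^ 2 + ε with hu
  set u1 : Fin n → ℝ × EuclideanSpace ℝ (Fin n) → ℝ :=
    fun j p => 2 * Real.sin p.1 ^ 2 * ∑ i, A1 i p * A2 i j p with hu1
  set u2 : Fin n → ℝ × EuclideanSpace ℝ (Fin n) → ℝ :=
    fun j p => 2 * Real.sin p.1 ^ 2 * ∑ i, (A2 i j p ^ 2 + A1 i p * A3 i j p) with hu2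
  set R : Fin n → ℝ × EuclideanSpace ℝ (Fin n) → ℝ :=
    fun j p => Real.sin p.1 ^ 2 * ∑ i, A2 i j p ^ 2 with hR
  have bu : IsBC u := (bs.sq.mul (IsBC.sum _ fun i => (bA1 i).sq)).add (IsBC.const ε)
  have bu1 : ∀ j, IsBC (u1 j) := fun j =>
    ((IsBC.const 2).mul bs.sq).mul (IsBC.sum _ fun i => (bA1 i).mul (bA2 i j))
  have bu2 : ∀ j, IsBC (u2 j) := fun j =>
    ((IsBC.const 2).mul bs.sq).mul (IsBC.sum _ fun i =>
      (bA2 i j).sq.add ((bA1 i).mul (bA3 i j)))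
  have bR : ∀ j, IsBC (R j) := fun j => bs.sq.mul (IsBC.sum _ fun i => (bA2 i j).sq)
  -- The curve `(A0, u)` stays in a compact subset of `U`.
  obtain ⟨C, hC⟩ := bu.2
  have hmem : ∀ p, (A0 p, u p) ∈ Set.Icc a' b' ×ˢ Set.Icc ε C := fun p =>
    ⟨ouAvg_mem_Icc hf.isBC hfab p, by
      have : 0 ≤ Real.sin p.1 ^ 2 * ∑ i, A1 i p ^ 2 := by positivity
      simp only [hu]; linarith, (le_abs_self _).trans (hC p)⟩
  have hsub : Set.Icc a' b' ×ˢ Set.Icc ε C ⊆ U := by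
    rintro p ⟨h1, h2⟩
    exact ⟨⟨ha.trans_le h1.1, h1.2.trans_lt hb⟩, hε.trans_le h2.1⟩
  have hmemU : ∀ p, (A0 p, u p) ∈ U := fun p => hsub (hmem p)
  have bcomp : ∀ g : ℝ × ℝ → ℝ, ContinuousOn g U → IsBC fun p => g (A0 p, u p) := by
    intro g hg
    refine ⟨hg.comp_continuous (bA0.1.prodMk bu.1) hmemU, ?_⟩
    obtain ⟨D, hD⟩ := (isCompact_Icc.prod isCompact_Icc).exists_bound_of_continuousOn
      (hg.mono hsub)
    exact ⟨D, fun p => hD _ (hmem p)⟩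
  have bN := bcomp _ hN.continuousOn
  have bN1 := bcomp _ hN1.continuousOn
  have bN2 := bcomp _ hN2.continuousOn
  have bN11 := bcomp _ hN11.continuousOn
  have bN12 := bcomp _ hN12.continuousOn
  have bN22 := bcomp _ hN22.continuousOn
  have dN : ∀ p, DifferentiableAt ℝ N (A0 p, u p) := fun p =>
    (hN.contDiffAt (hU.mem_nhds (hmemU p))).differentiableAt (by norm_num)
  have dN1 : ∀ p, DifferentiableAt ℝ (pderivFst N) (A0 p, u p) := fun p =>
    (hN1.contDiffAt (hU.mem_nhds (hmemU p))).differentiableAt (by norm_num)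
  have dN2 : ∀ p, DifferentiableAt ℝ (pderivSnd N) (A0 p, u p) := fun p =>
    (hN2.contDiffAt (hU.mem_nhds (hmemU p))).differentiableAt (by norm_num)
  set K : Fin n → ℝ × EuclideanSpace ℝ (Fin n) → ℝ := fun j p =>
    pderivFst N (A0 p, u p) * A1 j p + pderivSnd N (A0 p, u p) * u1 j p with hK
  set L : Fin n → ℝ × EuclideanSpace ℝ (Fin n) → ℝ := fun j p =>
    pderivFst N (A0 p, u p) * A2 j j p + pderivSnd N (A0 p, u p) * u2 j p with hL
  set S : Fin n → ℝ × EuclideanSpace ℝ (Fin n) → ℝ := fun j p =>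
    pderivFst (pderivFst N) (A0 p, u p) * A1 j p ^ 2
      + 2 * pderivSnd (pderivFst N) (A0 p, u p) * A1 j p * u1 j p
      + pderivSnd (pderivSnd N) (A0 p, u p) * u1 j p ^ 2 with hS
  set T : Fin n → ℝ × EuclideanSpace ℝ (Fin n) → ℝ := fun j p =>
    2 * pderivSnd N (A0 p, u p) * (A1 j p ^ 2 + R j p) with hT
  have bK : ∀ j, IsBC (K j) := fun j => (bN1.mul (bA1 j)).add (bN2.mul (bu1 j))
  have bL : ∀ j, IsBC (L j) := fun j => (bN1.mul (bA2 j j)).add (bN2.mul (bu2 j))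
  have bS : ∀ j, IsBC (S j) := fun j =>
    ((bN11.mul (bA1 j).sq).add ((((IsBC.const 2).mul bN12).mul (bA1 j)).mul (bu1 j))).add
      (bN22.mul (bu1 j).sq)
  have bT : ∀ j, IsBC (T j) := fun j =>
    ((IsBC.const 2).mul bN2).mul ((bA1 j).sq.add (bR j))
  have hST : ∀ j p, S j p + T j p ≤ 0 := by
    intro j p
    refine hcond _ (hmemU p) (A1 j p) (u1 j p) (R j p) ?_
    have h1 : (∑ i, A1 i p * A2 i j p) ^ 2 ≤ (∑ i, A1 i p ^ 2) * ∑ i, A2 i j p ^ 2 :=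
      Finset.sum_mul_sq_le_sq_mul_sq _ _ _
    have h2 : 0 ≤ Real.sin p.1 ^ 2 * ∑ i, A2 i j p ^ 2 := by positivity
    have h3 := mul_le_mul_of_nonneg_left h1 (by positivity : 0 ≤ 4 * (Real.sin p.1 ^ 2) ^ 2)
    simp only [hu, hu1, hR]
    nlinarith [mul_nonneg hε.le h2]
  -- Derivatives in the space directions.
  have lu : ∀ θ w j, HasLineDerivAt ℝ (fun w => u (θ, w)) (Real.sin θ * u1 j (θ, w)) w
      (EuclideanSpace.single j 1) := by
    intro θ w j
    have h1 : ∀ i, HasDerivAt _ _ _ := fun i => (hasLineDerivAt_ouAvg (hf1 i) θ w j).fun_pow 2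
    have h2 := ((HasDerivAt.fun_sum (u := Finset.univ) fun i _ => h1 i).const_mul
      (Real.sin θ ^ 2)).add_const ε
    rw [HasLineDerivAt]
    convert! h2 using 1
    simp only [hu1, Finset.mul_sum, zero_smul, add_zero]
    refine Finset.sum_congr rfl fun i _ => ?_
    simp only [hA1, hA2]; push_cast; ring
  have lu1 : ∀ θ w j, HasLineDerivAt ℝ (fun w => u1 j (θ, w)) (Real.sin θ * u2 j (θ, w)) w
      (EuclideanSpace.single j 1) := by
    intro θ w j
    have h1 : ∀ i, HasDerivAt _ _ _ := fun i =>
      HasDerivAt.fun_mul (hasLineDerivAt_ouAvg (hf1 i) θ w j) (hasLineDerivAt_ouAvg (hf2 i j) θ w j)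
    have h2 := (HasDerivAt.fun_sum (u := Finset.univ) fun i _ => h1 i).const_mul
      (2 * Real.sin θ ^ 2)
    rw [HasLineDerivAt]
    convert! h2 using 1
    simp only [hu2, Finset.mul_sum, zero_smul, add_zero]
    refine Finset.sum_congr rfl fun i _ => ?_
    simp only [hA1, hA2, hA3]; ring
  have lK : ∀ θ w j, HasLineDerivAt ℝ (fun w => K j (θ, w))
      (Real.sin θ * (S j (θ, w) + L j (θ, w))) w (EuclideanSpace.single j 1) := by
    intro θ w j
    have hX : HasDerivAt _ _ _ := hasLineDerivAt_ouAvg hf θ w j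
    have hY : HasDerivAt _ _ _ := lu θ w j
    have hd1 := hasDerivAt_comp_pair (by simpa using dN1 (θ, w)) hX hY
    have hd2 := hasDerivAt_comp_pair (by simpa using dN2 (θ, w)) hX hY
    have h1 : HasDerivAt _ _ _ := hasLineDerivAt_ouAvg (hf1 j) θ w j
    have h2 : HasDerivAt _ _ _ := lu1 θ w j
    have h3 := (hd1.fun_mul h1).fun_add (hd2.fun_mul h2)
    rw [HasLineDerivAt]
    convert! h3 using 1
    have hsymm := pderivFst_pderivSnd hU hN (hmemU (θ, w))
    simp only [zero_smul, add_zero]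
    simp only [pderivFst, pderivSnd] at hsymm
    simp only [hS, hL, hA1, hA2, pderivFst, pderivSnd] at hsymm ⊢
    rw [hsymm]
    ring
  -- Derivative in the time direction.
  have tu : ∀ θ w, HasDerivAt (fun θ => u (θ, w))
      (Real.cos θ * ∑ j, (w j * u1 j (θ, w) - Real.sin θ * u2 j (θ, w)
        + 2 * Real.sin θ * (A1 j (θ, w) ^ 2 + R j (θ, w)))) θ := by
    intro θ w
    have h1 := fun i => (hasDerivAt_ouAvg (hf1 i) θ w).fun_pow 2
    have h2 := (((Real.hasDerivAt_sin θ).fun_pow 2).fun_mul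
      (HasDerivAt.fun_sum (u := Finset.univ) fun i _ => h1 i)).add_const ε
    convert! h2 using 1
    have h3 : ∀ j, w j * u1 j (θ, w) - Real.sin θ * u2 j (θ, w)
        + 2 * Real.sin θ * (A1 j (θ, w) ^ 2 + R j (θ, w))
        = 2 * Real.sin θ * A1 j (θ, w) ^ 2 + Real.sin θ ^ 2 * ∑ i, 2 * A1 i (θ, w) *
          (w j * A2 i j (θ, w) - Real.sin θ * A3 i j (θ, w)) := by
      intro j
      have h4 : ∑ i, 2 * A1 i (θ, w) * (w j * A2 i j (θ, w) - Real.sin θ * A3 i j (θ, w))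
          = 2 * w j * ∑ i, A1 i (θ, w) * A2 i j (θ, w)
            - 2 * Real.sin θ * ∑ i, A1 i (θ, w) * A3 i j (θ, w) := by
        rw [Finset.mul_sum, Finset.mul_sum, ← Finset.sum_sub_distrib]
        exact Finset.sum_congr rfl fun i _ => by ring
      rw [h4]
      simp only [hu1, hu2, hR, Finset.sum_add_distrib]
      ring
    have h5 : ∑ i, 2 * A1 i (θ, w) * (Real.cos θ *
        ∑ j, (w j * A2 i j (θ, w) - Real.sin θ * A3 i j (θ, w)))
        = Real.cos θ * ∑ j, ∑ i, 2 * A1 i (θ, w) *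
          (w j * A2 i j (θ, w) - Real.sin θ * A3 i j (θ, w)) := by
      rw [Finset.sum_comm, Finset.mul_sum]
      refine Finset.sum_congr rfl fun i _ => ?_
      rw [← Finset.mul_sum]
      ring
    simp_rw [h3, Finset.sum_add_distrib, ← Finset.mul_sum]
    simp only [Nat.cast_ofNat, Nat.add_one_sub_one, pow_one]
    simp only [hA1, hA2, hA3] at h5 ⊢
    rw [h5]
    ring
  have tN : ∀ θ w, HasDerivAt (fun θ => N (A0 (θ, w), u (θ, w)))
      (∑ j, (w j * (Real.cos θ * K j (θ, w))
        + Real.cos θ * Real.sin θ * (T j (θ, w) - L j (θ, w)))) θ := by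
    intro θ w
    have h1 := hasDerivAt_comp_pair (dN (θ, w)) (hasDerivAt_ouAvg hf θ w) (tu θ w)
    convert! h1 using 1
    simp only [Finset.mul_sum]
    rw [← Finset.sum_add_distrib]
    refine Finset.sum_congr rfl fun j _ => ?_
    simp only [hK, hL, hT, hA1, hA2, pderivFst, pderivSnd]
    ring
  have hderiv := hasDerivAt_integral_of_linear_growth bN (fun j => bc.mul (bK j))
    (fun j => (bc.mul bs).mul ((bT j).add ((IsBC.const (-1)).mul (bL j))))
    (fun θ w => by convert! tN θ w using 1; exact Finset.sum_congr rfl fun j _ => by ring)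
  have hanti : AntitoneOn (fun θ => ∫ w, N (A0 (θ, w), u (θ, w)) ∂gaussMeasure n)
      (Set.Icc 0 (π / 2)) := by
    refine antitoneOn_of_deriv_nonpos (convex_Icc _ _)
      (fun θ _ => (hderiv θ).continuousAt.continuousWithinAt)
      (fun θ _ => (hderiv θ).differentiableAt.differentiableWithinAt) fun θ hθ => ?_
    rw [interior_Icc] at hθ
    have hs : 0 ≤ Real.sin θ :=
      Real.sin_nonneg_of_nonneg_of_le_pi hθ.1.le (by linarith [hθ.2, Real.pi_pos])
    have hc : 0 ≤ Real.cos θ :=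
      Real.cos_nonneg_of_neg_pi_div_two_le_of_le (by linarith [hθ.1, Real.pi_pos]) hθ.2.le
    have hcont : Continuous fun w : EuclideanSpace ℝ (Fin n) => (θ, w) := by fun_prop
    rw [(hderiv θ).deriv]
    refine Finset.sum_nonpos fun j _ => ?_
    have hst := ((bK j).comp hcont).integral_coord_mul
      ((IsBC.const (Real.sin θ)).mul (((bS j).add (bL j)).comp hcont)) j (fun w => lK θ w j)
    have e1 : ∫ w, w j * (Real.cos θ * K j (θ, w)) ∂gaussMeasure n
        = Real.cos θ * ∫ w, w j * K j (θ, w) ∂gaussMeasure n := by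
      rw [← integral_const_mul]; congr 1; ext w; ring
    rw [e1, hst, ← integral_const_mul, ← integral_add]
    · refine integral_nonpos fun w => ?_
      have := mul_nonpos_of_nonneg_of_nonpos (mul_nonneg hc hs) (hST j (θ, w))
      simp only [Pi.zero_apply]
      linarith
    · exact ((IsBC.const _).mul ((IsBC.const (Real.sin θ)).mul
        (((bS j).add (bL j)).comp hcont))).integrable
    · exact (((bc.mul bs).mul ((bT j).add ((IsBC.const (-1)).mul (bL j)))).comp hcont).integrable
  have := hanti (Set.left_mem_Icc.2 (by positivity)) (Set.right_mem_Icc.2 (by positivity))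
    (by positivity : (0 : ℝ) ≤ π / 2)
  simpa [hu, hA0, hA1, ouAvg] using this

end Monotonicity

section Hypotheses

variable {a b : ℝ} {M : ℝ → ℝ → ℝ}

lemma isOpen_Ioo_prod_Ioi : IsOpen (Set.Ioo a b ×ˢ Set.Ioi (0 : ℝ)) := isOpen_Ioo.prod isOpen_Ioi

lemma hasDerivAt_comp_sq {g : ℝ × ℝ → ℝ} {x y : ℝ} (hg : DifferentiableAt ℝ g (x, y ^ 2)) :
    HasDerivAt (fun s => g (x, s ^ 2)) (2 * y * pderivSnd g (x, y ^ 2)) y := by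
  have h := hasDerivAt_comp_pair hg (hasDerivAt_const y x)
    (by simpa using hasDerivAt_pow 2 y : HasDerivAt (fun s : ℝ => s ^ 2) (2 * y) y)
  convert! h using 1
  simp [pderivSnd]; ring

lemma hasDerivAt_comp_fst {g : ℝ × ℝ → ℝ} {x u : ℝ} (hg : DifferentiableAt ℝ g (x, u)) :
    HasDerivAt (fun s => g (s, u)) (pderivFst g (x, u)) x := by
  have h := hasDerivAt_comp_pair hg (hasDerivAt_id x) (hasDerivAt_const x u)
  convert! h using 1
  simp [pderivFst]

/-- The partial derivatives of `M` expressed through those of `N (x, u) = M x (√u)`. -/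
lemma partials_eq {N : ℝ × ℝ → ℝ} (hMN : ∀ x y, 0 ≤ y → M x y = N (x, y ^ 2))
    (hN : ContDiffOn ℝ 2 N (Set.Ioo a b ×ˢ Set.Ioi 0)) {x y : ℝ} (hx : x ∈ Set.Ioo a b)
    (hy : 0 < y) :
    My M x y = 2 * y * pderivSnd N (x, y ^ 2) ∧
    Mxx M x y = pderivFst (pderivFst N) (x, y ^ 2) ∧
    Mxy M x y = 2 * y * pderivSnd (pderivFst N) (x, y ^ 2) ∧
    Myy M x y = 2 * pderivSnd N (x, y ^ 2) + 4 * y ^ 2 * pderivSnd (pderivSnd N) (x, y ^ 2) := by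
  have hU := isOpen_Ioo_prod_Ioi (a := a) (b := b)
  have hN1 : ContDiffOn ℝ 1 (pderivFst N) _ := contDiffOn_fderiv_apply hU hN (by norm_num) _
  have hN2 : ContDiffOn ℝ 1 (pderivSnd N) _ := contDiffOn_fderiv_apply hU hN (by norm_num) _
  have hmem : ∀ {x y : ℝ}, x ∈ Set.Ioo a b → 0 < y →
      (x, y ^ 2) ∈ Set.Ioo a b ×ˢ Set.Ioi (0 : ℝ) := fun hx hy => ⟨hx, Set.mem_Ioi.2 (by positivity)⟩
  have diff : ∀ {g : ℝ × ℝ → ℝ} {x y : ℝ}, ContDiffOn ℝ 1 g (Set.Ioo a b ×ˢ Set.Ioi 0) →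
      x ∈ Set.Ioo a b → 0 < y → DifferentiableAt ℝ g (x, y ^ 2) := fun hg hx hy =>
    (hg.contDiffAt (hU.mem_nhds (hmem hx hy))).differentiableAt (by norm_num)
  have hN' : ContDiffOn ℝ 1 N (Set.Ioo a b ×ˢ Set.Ioi 0) := hN.of_le (by norm_num)
  have eMx : ∀ {x y : ℝ}, x ∈ Set.Ioo a b → 0 < y → Mx M x y = pderivFst N (x, y ^ 2) := by
    intro x y hx hy
    unfold Mx
    rw [funext fun s => hMN s y hy.le]
    exact (hasDerivAt_comp_fst (diff hN' hx hy)).deriv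
  have eMy : ∀ {x y : ℝ}, x ∈ Set.Ioo a b → 0 < y →
      My M x y = 2 * y * pderivSnd N (x, y ^ 2) := by
    intro x y hx hy
    have h1 : (fun s => M x s) =ᶠ[nhds y] fun s => N (x, s ^ 2) := by
      filter_upwards [lt_mem_nhds hy] with s hs using hMN x s hs.le
    rw [My, h1.deriv_eq]
    exact (hasDerivAt_comp_sq (diff hN' hx hy)).deriv
  refine ⟨eMy hx hy, ?_, ?_, ?_⟩
  · have h1 : (fun s => Mx M s y) =ᶠ[nhds x] fun s => pderivFst N (s, y ^ 2) := by
      filter_upwards [isOpen_Ioo.mem_nhds hx] with s hs using eMx hs hy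
    rw [Mxx, h1.deriv_eq]
    exact (hasDerivAt_comp_fst (diff hN1 hx hy)).deriv
  · have h1 : (fun s => Mx M x s) =ᶠ[nhds y] fun s => pderivFst N (x, s ^ 2) := by
      filter_upwards [lt_mem_nhds hy] with s hs using eMx hx hs
    rw [Mxy, h1.deriv_eq]
    exact (hasDerivAt_comp_sq (diff hN1 hx hy)).deriv
  · have h1 : (fun s => My M x s) =ᶠ[nhds y] fun s => 2 * s * pderivSnd N (x, s ^ 2) := by
      filter_upwards [lt_mem_nhds hy] with s hs using eMy hx hs
    rw [Myy, h1.deriv_eq]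
    have h2 : HasDerivAt (fun s : ℝ => 2 * s) 2 y := by
      simpa using (hasDerivAt_id y).const_mul 2
    rw [(h2.fun_mul (hasDerivAt_comp_sq (diff hN2 hx hy))).deriv]
    ring

lemma quadratic_form_nonpos {x y : ℝ} (h : (Mmat M x y).NegSemidef') (α β : ℝ) :
    (Mxx M x y + My M x y / y) * α ^ 2 + 2 * Mxy M x y * α * β + Myy M x y * β ^ 2 ≤ 0 := by
  have := h.dotProduct_mulVec_nonneg ![α, β]
  simp [Mmat, Matrix.mulVec, dotProduct, Fin.sum_univ_two] at this
  linarith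

/-- `M_y ≤ 0`, since `M` is concave in `y` and even at `y = 0`. -/
lemma pderivSnd_nonpos {N : ℝ × ℝ → ℝ} (hMN : ∀ x y, 0 ≤ y → M x y = N (x, y ^ 2))
    (hN : ContDiffOn ℝ 2 N (Set.Icc a b ×ˢ Set.Ici 0))
    (hNeg : ∀ x ∈ Set.Icc a b, ∀ y : ℝ, 0 < y → (Mmat M x y).NegSemidef')
    {x u : ℝ} (hx : x ∈ Set.Ioo a b) (hu : 0 < u) : pderivSnd N (x, u) ≤ 0 := by
  have hN' : ContDiffOn ℝ 2 N (Set.Ioo a b ×ˢ Set.Ioi 0) :=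
    hN.mono (Set.prod_mono Set.Ioo_subset_Icc_self Set.Ioi_subset_Ici_self)
  have hNt : ContDiffOn ℝ 2 (fun t => N (x, t)) (Set.Ici 0) :=
    hN.comp (by fun_prop) fun t ht => ⟨Set.Ioo_subset_Icc_self hx, ht⟩
  have hmaps : Set.MapsTo (fun y : ℝ => y ^ 2) (Set.Ici 0) (Set.Ici 0) := fun y _ => sq_nonneg y
  set m : ℝ → ℝ := fun y => N (x, y ^ 2) with hm
  have hmc : ContDiffOn ℝ 2 m (Set.Ici 0) := hNt.comp (by fun_prop) hmaps
  have hdiff : ∀ y, 0 < y → DifferentiableAt ℝ N (x, y ^ 2) := fun y hy =>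
    (hN'.contDiffAt (isOpen_Ioo_prod_Ioi.mem_nhds
      ⟨hx, Set.mem_Ioi.2 (by positivity)⟩)).differentiableAt (by norm_num)
  have hmd : ∀ y, 0 < y → HasDerivAt m (My M x y) y := fun y hy => by
    rw [(partials_eq hMN hN' hx hy).1]
    exact hasDerivAt_comp_sq (hdiff y hy)
  have hconc : ConcaveOn ℝ (Set.Ici 0) m := by
    refine concaveOn_of_deriv2_nonpos (convex_Ici 0) hmc.continuousOn ?_ ?_ ?_
    · exact (hmc.differentiableOn (by norm_num)).mono interior_subset
    · rw [interior_Ici]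
      exact ((hmc.mono Set.Ioi_subset_Ici_self).deriv_of_isOpen (m := 1) isOpen_Ioi
        (by norm_num)).differentiableOn (by norm_num)
    · rw [interior_Ici]
      intro y hy
      have h1 : deriv m =ᶠ[nhds y] fun s => My M x s := by
        filter_upwards [lt_mem_nhds hy] with s hs using (hmd s hs).deriv
      have h2 := quadratic_form_nonpos (hNeg x (Set.Ioo_subset_Icc_self hx) y hy) 0 1
      have h3 : deriv^[2] m y = Myy M x y := by
        simp only [Function.iterate_succ, Function.iterate_zero, Function.comp_apply, id]
        rw [h1.deriv_eq, Myy]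
      rw [h3]
      simpa using h2
  have h0 : HasDerivWithinAt m 0 (Set.Ici 0) 0 := by
    have h1 : HasDerivWithinAt (fun t => N (x, t))
        (derivWithin (fun t => N (x, t)) (Set.Ici 0) ((0 : ℝ) ^ 2)) (Set.Ici 0) ((0 : ℝ) ^ 2) :=
      (hNt.differentiableOn (by norm_num) _ (by simp)).hasDerivWithinAt
    have h2 : HasDerivWithinAt (fun y : ℝ => y ^ 2) 0 (Set.Ici 0) 0 := by
      simpa using (hasDerivAt_pow 2 (0 : ℝ)).hasDerivWithinAt
    simpa [Function.comp_def] using 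
      HasDerivWithinAt.scomp (h := fun y : ℝ => y ^ 2) (0 : ℝ) h1 h2 hmaps
  have hsu : 0 < Real.sqrt u := Real.sqrt_pos.2 hu
  have h1 := hconc.slope_le_of_hasDerivWithinAt (Set.self_mem_Ici) hsu.le hsu h0
  have h2 := hconc.le_slope_of_hasDerivAt (Set.self_mem_Ici) hsu.le hsu (hmd _ hsu)
  have h3 := h2.trans h1
  rw [(partials_eq hMN hN' hx hsu).1, Real.sq_sqrt hu.le] at h3
  by_contra hpos
  push Not at hpos
  have : 0 < 2 * Real.sqrt u * pderivSnd N (x, u) := by positivity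
  linarith

lemma quadratic_form_nonpos_of_le {N : ℝ × ℝ → ℝ} (hMN : ∀ x y, 0 ≤ y → M x y = N (x, y ^ 2))
    (hN : ContDiffOn ℝ 2 N (Set.Icc a b ×ˢ Set.Ici 0))
    (hNeg : ∀ x ∈ Set.Icc a b, ∀ y : ℝ, 0 < y → (Mmat M x y).NegSemidef')
    {p : ℝ × ℝ} (hp : p ∈ Set.Ioo a b ×ˢ Set.Ioi (0 : ℝ)) (α v r : ℝ)
    (hv : v ^ 2 ≤ 4 * p.2 * r) :
    pderivFst (pderivFst N) p * α ^ 2 + 2 * pderivSnd (pderivFst N) p * α * v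
      + pderivSnd (pderivSnd N) p * v ^ 2 + 2 * pderivSnd N p * (α ^ 2 + r) ≤ 0 := by
  obtain ⟨x, u⟩ := p
  obtain ⟨hx, hu : 0 < u⟩ := hp
  have hN' : ContDiffOn ℝ 2 N (Set.Ioo a b ×ˢ Set.Ioi 0) :=
    hN.mono (Set.prod_mono Set.Ioo_subset_Icc_self Set.Ioi_subset_Ici_self)
  obtain ⟨y, hy, rfl⟩ : ∃ y, 0 < y ∧ y ^ 2 = u := ⟨√u, Real.sqrt_pos.2 hu, Real.sq_sqrt hu.le⟩
  obtain ⟨e1, e2, e3, e4⟩ := partials_eq hMN hN' hx hy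
  have hq := quadratic_form_nonpos (hNeg x (Set.Ioo_subset_Icc_self hx) y hy) α (v / (2 * y))
  have hn := pderivSnd_nonpos hMN hN hNeg hx hu
  rw [e1, e2, e3, e4] at hq
  have hr : v ^ 2 / (4 * y ^ 2) ≤ r := by
    rw [div_le_iff₀ (by positivity)]; simpa [mul_comm] using hv
  have h1 := mul_le_mul_of_nonpos_left hr hn
  have h2 : (pderivFst (pderivFst N) (x, y ^ 2) + 2 * y * pderivSnd N (x, y ^ 2) / y) * α ^ 2
      + 2 * (2 * y * pderivSnd (pderivFst N) (x, y ^ 2)) * α * (v / (2 * y))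
      + (2 * pderivSnd N (x, y ^ 2) + 4 * y ^ 2 * pderivSnd (pderivSnd N) (x, y ^ 2))
        * (v / (2 * y)) ^ 2
      = pderivFst (pderivFst N) (x, y ^ 2) * α ^ 2
      + 2 * pderivSnd (pderivFst N) (x, y ^ 2) * α * v
      + pderivSnd (pderivSnd N) (x, y ^ 2) * v ^ 2
      + 2 * pderivSnd N (x, y ^ 2) * α ^ 2
      + 2 * (pderivSnd N (x, y ^ 2) * (v ^ 2 / (4 * y ^ 2))) := by
    field_simp
    ring
  rw [h2] at hq
  linarith

end Hypotheses

section Approximation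

variable {n : ℕ} {f : EuclideanSpace ℝ (Fin n) → ℝ}

lemma BoundedSmooth.const_mul_add_const (hf : BoundedSmooth f) (c d : ℝ) :
    BoundedSmooth fun x => c * f x + d := by
  have h1 : ContDiff ℝ (⊤ : ℕ∞) fun x => c * f x := contDiff_const.mul hf.1
  refine ⟨h1.add contDiff_const, fun i => ?_⟩
  obtain ⟨C, hC⟩ := hf.2 i
  refine ⟨|c| * C + |d|, fun x => ?_⟩
  have hi : (i : WithTop ℕ∞) ≤ ((⊤ : ℕ∞) : WithTop ℕ∞) := by exact_mod_cast le_top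
  have h2 : iteratedFDeriv ℝ i (fun x => c * f x + d) x
      = c • iteratedFDeriv ℝ i f x
        + iteratedFDeriv ℝ i (fun _ : EuclideanSpace ℝ (Fin n) => d) x := by
    rw [← iteratedFDeriv_const_smul_apply (hf.1.of_le hi).contDiffAt]
    exact iteratedFDeriv_add_apply (h1.of_le hi).contDiffAt contDiff_const.contDiffAt
  rw [h2]
  refine (norm_add_le _ _).trans (add_le_add ?_ ?_)
  · rw [norm_smul, Real.norm_eq_abs]
    exact mul_le_mul_of_nonneg_left (hC x) (abs_nonneg _)
  · cases i with
    | zero => simp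
    | succ k => simp [iteratedFDeriv_succ_const]

lemma partialD_const_mul_add_const (hf : BoundedSmooth f) (c d : ℝ) (j : Fin n)
    (x : EuclideanSpace ℝ (Fin n)) : partialD j (fun x => c * f x + d) x = c * partialD j f x := by
  unfold partialD
  rw [(((hf.hasFDerivAt x).const_mul c).add_const d).fderiv]
  simp

lemma norm_fderiv_sq (x : EuclideanSpace ℝ (Fin n)) :
    ‖fderiv ℝ f x‖ ^ 2 = ∑ j, partialD j f x ^ 2 := by
  set v := (InnerProductSpace.toDual ℝ (EuclideanSpace ℝ (Fin n))).symm (fderiv ℝ f x) with hv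
  have h1 : ‖v‖ = ‖fderiv ℝ f x‖ := LinearIsometryEquiv.norm_map _ _
  rw [← h1, EuclideanSpace.real_norm_sq_eq]
  refine Finset.sum_congr rfl fun j _ => ?_
  have h2 : inner ℝ v (EuclideanSpace.single j (1 : ℝ)) = partialD j f x := by
    rw [hv, InnerProductSpace.toDual_symm_apply, partialD]
  rw [← h2, EuclideanSpace.inner_single_right]
  simp

/-- The Gaussian inequality in the variables `(x, u)` with `u = y²`. -/
theorem integral_le_of_quadratic_form {a b : ℝ} (hab : a < b) {N : ℝ × ℝ → ℝ}
    (hN : ContDiffOn ℝ 2 N (Set.Icc a b ×ˢ Set.Ici 0))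
    (hcond : ∀ p ∈ Set.Ioo a b ×ˢ Set.Ioi 0, ∀ α v r : ℝ, v ^ 2 ≤ 4 * p.2 * r →
      pderivFst (pderivFst N) p * α ^ 2 + 2 * pderivSnd (pderivFst N) p * α * v
        + pderivSnd (pderivSnd N) p * v ^ 2 + 2 * pderivSnd N p * (α ^ 2 + r) ≤ 0)
    (hf : BoundedSmooth f) (hfab : ∀ x, f x ∈ Set.Icc a b) :
    ∫ x, N (f x, ∑ j, partialD j f x ^ 2) ∂gaussMeasure n
      ≤ N (∫ x, f x ∂gaussMeasure n, 0) := by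
  set m := (a + b) / 2 with hm
  set D : Set (ℝ × ℝ) := Set.Icc a b ×ˢ Set.Ici 0 with hD
  set G : EuclideanSpace ℝ (Fin n) → ℝ := fun x => ∑ j, partialD j f x ^ 2 with hG
  have hG0 : ∀ x, 0 ≤ G x := fun x => Finset.sum_nonneg fun j _ => sq_nonneg _
  have bG : IsBC G := IsBC.sum _ fun j => (hf.partialD j).isBC.sq
  obtain ⟨C, hC⟩ := bG.2
  have hmean : ∫ x, f x ∂gaussMeasure n ∈ Set.Icc a b := by
    simpa [ouAvg] using ouAvg_mem_Icc hf.isBC hfab (0, 0)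
  have hunit : ∀ᶠ ε : ℝ in nhdsWithin 0 (Set.Ioi 0), ε ∈ Set.Ioo (0 : ℝ) 1 :=
    Ioo_mem_nhdsGT one_pos
  have hconv : ∀ {t ε : ℝ}, t ∈ Set.Icc a b → ε ∈ Set.Ioo (0 : ℝ) 1 →
      (1 - ε) * t + ε * m ∈ Set.Icc a b := by
    intro t ε ht hε
    have hma : a ≤ m := by linarith
    have hmb : m ≤ b := by linarith
    have h1 : 0 ≤ 1 - ε := by linarith [hε.2]
    constructor
    · nlinarith [mul_le_mul_of_nonneg_left ht.1 h1, mul_le_mul_of_nonneg_left hma hε.1.le]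
    · nlinarith [mul_le_mul_of_nonneg_left ht.2 h1, mul_le_mul_of_nonneg_left hmb hε.1.le]
  have hlim : ∀ {t g : ℝ}, t ∈ Set.Icc a b → 0 ≤ g → Filter.Tendsto
      (fun ε : ℝ => N ((1 - ε) * t + ε * m, (1 - ε) ^ 2 * g + ε)) (nhdsWithin 0 (Set.Ioi 0))
      (nhds (N (t, g))) := by
    intro t g ht hg
    refine (hN.continuousOn (t, g) ⟨ht, hg⟩).tendsto.comp (tendsto_nhdsWithin_iff.2 ⟨?_, ?_⟩)
    · have : Continuous fun ε : ℝ => ((1 - ε) * t + ε * m, (1 - ε) ^ 2 * g + ε) := by fun_prop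
      simpa using (this.tendsto 0).mono_left nhdsWithin_le_nhds
    · filter_upwards [hunit] with ε hε
      exact ⟨hconv ht hε, add_nonneg (mul_nonneg (sq_nonneg _) hg) hε.1.le⟩
  have hineq : ∀ᶠ ε : ℝ in nhdsWithin 0 (Set.Ioi 0),
      ∫ x, N ((1 - ε) * f x + ε * m, (1 - ε) ^ 2 * G x + ε) ∂gaussMeasure n
        ≤ N ((1 - ε) * (∫ x, f x ∂gaussMeasure n) + ε * m, (1 - ε) ^ 2 * 0 + ε) := by
    filter_upwards [hunit] with ε hε
    have h1 : 0 ≤ 1 - ε := by linarith [hε.2]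
    have key := integral_le_of_interior (a' := (1 - ε) * a + ε * m) (b' := (1 - ε) * b + ε * m)
      (by nlinarith [hε.1]) (by nlinarith [hε.1]) hε.1
      (hN.mono (Set.prod_mono Set.Ioo_subset_Icc_self Set.Ioi_subset_Ici_self)) hcond
      (hf.const_mul_add_const (1 - ε) (ε * m)) (fun x =>
        ⟨by nlinarith [mul_le_mul_of_nonneg_left (hfab x).1 h1],
          by nlinarith [mul_le_mul_of_nonneg_left (hfab x).2 h1]⟩)
    rw [integral_add (hf.isBC.integrable.const_mul _) (integrable_const _),
      integral_const_mul] at key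
    simpa [partialD_const_mul_add_const hf, mul_pow, ← Finset.mul_sum] using key
  refine le_of_tendsto_of_tendsto ?_ (hlim hmean le_rfl) hineq
  obtain ⟨B, hB⟩ := (isCompact_Icc.prod (isCompact_Icc (a := (0 : ℝ)) (b := C + 1))
    |>.exists_bound_of_continuousOn (f := N) (hN.continuousOn.mono
      (Set.prod_mono (le_refl (Set.Icc a b)) Set.Icc_subset_Ici_self)))
  refine tendsto_integral_filter_of_dominated_convergence (fun _ => B) ?_ ?_ (integrable_const _)
    (ae_of_all _ fun x => hlim (hfab x) (hG0 x))
  · filter_upwards [hunit] with ε hε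
    refine (hN.continuousOn.comp_continuous ?_ fun x =>
      ⟨hconv (hfab x) hε, add_nonneg (mul_nonneg (sq_nonneg _) (hG0 x)) hε.1.le⟩
      ).aestronglyMeasurable
    have h1 := hf.1.continuous
    have h2 := bG.1
    fun_prop
  · filter_upwards [hunit] with ε hε
    refine ae_of_all _ fun x => hB _ ⟨hconv (hfab x) hε,
      add_nonneg (mul_nonneg (sq_nonneg _) (hG0 x)) hε.1.le, ?_⟩
    have h1 : (1 - ε) ^ 2 ≤ 1 := by nlinarith [hε.1, hε.2]
    have h2 := mul_le_mul_of_nonneg_right h1 (hG0 x)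
    have h3 := (le_abs_self _).trans (hC x)
    simp only
    linarith [hε.2]

end Approximation

/-- Theorem 1: if `M(x, √y)` is `C²` on `Ω × [0,∞)` and the matrix
`[[M_xx + M_y/y, M_xy], [M_xy, M_yy]]` is negative semidefinite, then
`∫ M(f, ‖∇f‖) dγ ≤ M(∫ f dγ, 0)` for the standard Gaussian measure `γ` on `ℝⁿ`. -/
theorem stmt_0 (a b : ℝ) (hab : a ≤ b) (M : ℝ → ℝ → ℝ)
    (hC2 : ContDiffOn ℝ 2 (fun p : ℝ × ℝ => M p.1 (Real.sqrt p.2))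
      (Set.Icc a b ×ˢ Set.Ici (0 : ℝ)))
    (hNeg : ∀ x ∈ Set.Icc a b, ∀ y : ℝ, 0 < y → (Mmat M x y).NegSemidef')
    (n : ℕ) (γ : Measure (EuclideanSpace ℝ (Fin n)))
    (hγ : γ = volume.withDensity
      (fun x => ENNReal.ofReal ((2 * π) ^ (-(n : ℝ) / 2) * Real.exp (-‖x‖ ^ 2 / 2))))
    (f : EuclideanSpace ℝ (Fin n) → ℝ)
    (hf : ContDiff ℝ (⊤ : ℕ∞) f)
    (hfΩ : ∀ x, f x ∈ Set.Icc a b)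
    (hfd : ∀ i : ℕ, ∃ C : ℝ, ∀ x, ‖iteratedFDeriv ℝ i f x‖ ≤ C) :
    ∫ x, M (f x) ‖fderiv ℝ f x‖ ∂γ ≤ M (∫ x, f x ∂γ) 0 := by
  have hγ' : γ = gaussMeasure n := hγ
  subst hγ'
  rcases hab.eq_or_lt with rfl | hlt
  · have hfa : f = fun _ => a := funext fun x => le_antisymm (hfΩ x).2 (hfΩ x).1
    simp [hfa]
  · have hMN : ∀ x y, 0 ≤ y → M x y = (fun p : ℝ × ℝ => M p.1 (Real.sqrt p.2)) (x, y ^ 2) :=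
      fun x y hy => by simp [Real.sqrt_sq hy]
    have key := integral_le_of_quadratic_form hlt hC2
      (fun p hp α v r hv => quadratic_form_nonpos_of_le hMN hC2 hNeg hp α v r hv)
      (f := f) ⟨hf, hfd⟩ hfΩ
    simpa [← norm_fderiv_sq, Real.sqrt_sq (norm_nonneg _)] using key
end

section
/- Let γ be the standard Gaussian measure on ℝⁿ and let f : ℝⁿ → (−1,1) be a smooth bounded function with bounded derivatives. Let r : ℝⁿ → [0,∞) be the function determined pointwise by the equation ‖∇f(x)‖² = r(x)·(e^{r(x)} − f(x)²) with r(x) > 0 when ∇f(x) ≠ 0 and r(x) = 0 when ∇f(x) = 0. Then ∫_{ℝⁿ} [ f·arccos(−f·e^{−r/2}) + (1 − r)·√(e^{r} − f²) ] dγ ≤ (∫_{ℝⁿ} f dγ)·arccos(−∫_{ℝⁿ} f dγ) + √(1 − (∫_{ℝⁿ} f dγ)²). -/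
open MeasureTheory Real

namespace GaussianArccos

/-- Euclidean space of dimension `n`. -/
abbrev Euc (n : ℕ) := EuclideanSpace ℝ (Fin n)

/-- The standard Gaussian density on `ℝⁿ`. -/
noncomputable def density (n : ℕ) (x : Euc n) : ℝ :=
  (2 * π) ^ (-(n : ℝ) / 2) * Real.exp (-‖x‖ ^ 2 / 2)

/-- The standard Gaussian measure on `ℝⁿ`. -/
noncomputable def gauss (n : ℕ) : Measure (Euc n) :=
  volume.withDensity fun x => ENNReal.ofReal (density n x)

variable {n : ℕ}

lemma density_pos (x : Euc n) : 0 < density n x := by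
  unfold density; positivity

lemma continuous_density : Continuous (density n) := by
  unfold density; fun_prop

lemma integrable_exp_neg_mul_sq {b : ℝ} (hb : 0 < b) :
    Integrable (fun x : Euc n => Real.exp (-b * ‖x‖ ^ 2)) := by
  have h := (GaussianFourier.integrable_cexp_neg_mul_sq_norm_add (V := Euc n) (b := (b : ℂ))
    (by simpa using hb) 0 0).norm
  refine h.congr (Filter.Eventually.of_forall fun x => ?_)
  simp [Complex.norm_exp, ← Complex.ofReal_pow]

lemma integrable_density : Integrable (density n) := by
  have h := (integrable_exp_neg_mul_sq (n := n) (b := 1 / 2) (by norm_num)).const_mul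
    ((2 * π) ^ (-(n : ℝ) / 2))
  refine h.congr (Filter.Eventually.of_forall fun x => ?_)
  simp only [density]
  congr 2; ring

lemma integral_density : ∫ x, density n x = 1 := by
  have h := GaussianFourier.integral_rexp_neg_mul_sq_norm (V := Euc n) (b := 1 / 2) (by norm_num)
  have h2 : ∀ x : Euc n, density n x
      = (2 * π) ^ (-(n : ℝ) / 2) * Real.exp (-(1 / 2) * ‖x‖ ^ 2) := by
    intro x; simp only [density]; congr 2; ring
  simp_rw [h2]
  rw [integral_const_mul, h, finrank_euclideanSpace_fin]
  have h3 : π / (1 / 2) = 2 * π := by ring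
  rw [h3, ← Real.rpow_add (by positivity)]
  have : -(n : ℝ) / 2 + n / 2 = 0 := by ring
  rw [this, Real.rpow_zero]

instance : IsProbabilityMeasure (gauss n) := by
  refine ⟨?_⟩
  rw [gauss, withDensity_apply _ MeasurableSet.univ, Measure.restrict_univ,
    ← ofReal_integral_eq_lintegral_ofReal integrable_density
      (Filter.Eventually.of_forall fun x => (density_pos x).le), integral_density]
  simp

lemma integral_gauss (g : Euc n → ℝ) : ∫ x, g x ∂(gauss n) = ∫ x, density n x * g x := by
  rw [gauss, integral_withDensity_eq_integral_toReal_smul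
    (continuous_density.measurable.ennreal_ofReal) (by simp)]
  simp [ENNReal.toReal_ofReal (density_pos _).le]

lemma integrable_gauss_iff (g : Euc n → ℝ) :
    Integrable g (gauss n) ↔ Integrable (fun x => density n x * g x) := by
  rw [gauss, integrable_withDensity_iff_integrable_smul'
    (continuous_density.measurable.ennreal_ofReal) (by simp)]
  simp [ENNReal.toReal_ofReal (density_pos _).le]

lemma integrable_norm_gauss : Integrable (fun x => ‖x‖) (gauss n) := by
  rw [integrable_gauss_iff]
  have h := (integrable_exp_neg_mul_sq (n := n) (b := 1 / 4) (by norm_num)).const_mul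
    ((2 * π) ^ (-(n : ℝ) / 2))
  refine h.mono' (continuous_density.mul continuous_norm).aestronglyMeasurable
    (Filter.Eventually.of_forall fun x => ?_)
  rw [Real.norm_of_nonneg (mul_nonneg (density_pos x).le (norm_nonneg x))]
  simp only [density]
  rw [mul_assoc]
  gcongr
  have h1 : ‖x‖ ≤ Real.exp (1 / 4 * ‖x‖ ^ 2) := by
    nlinarith [Real.add_one_le_exp (1 / 4 * ‖x‖ ^ 2), sq_nonneg (‖x‖ / 2 - 1)]
  calc Real.exp (-‖x‖ ^ 2 / 2) * ‖x‖
      ≤ Real.exp (-‖x‖ ^ 2 / 2) * Real.exp (1 / 4 * ‖x‖ ^ 2) := by gcongr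
    _ = Real.exp (-(1 / 4) * ‖x‖ ^ 2) := by rw [← Real.exp_add]; congr 1; ring

lemma integrable_of_bound {g : Euc n → ℝ} (hm : AEStronglyMeasurable g (gauss n)) {C : ℝ}
    (hC : ∀ x, |g x| ≤ C) : Integrable g (gauss n) :=
  (integrable_const C).mono' hm (Filter.Eventually.of_forall hC)

lemma integrable_of_bound_mul {g : Euc n → ℝ} (hm : AEStronglyMeasurable g (gauss n)) {A C : ℝ}
    (hC : ∀ x, |g x| ≤ A + C * ‖x‖) : Integrable g (gauss n) :=
  ((integrable_const A).add (integrable_norm_gauss.const_mul C)).mono' hm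
    (Filter.Eventually.of_forall hC)

lemma hasFDerivAt_density (x : Euc n) :
    HasFDerivAt (density n) (-(density n x) • innerSL ℝ x) x := by
  have h1 : HasFDerivAt (fun x : Euc n => ‖x‖ ^ 2) (2 • innerSL ℝ x) x :=
    (hasStrictFDerivAt_norm_sq x).hasFDerivAt
  have h2 := ((h1.neg.mul_const (1 / 2)).exp).const_mul ((2 * π) ^ (-(n : ℝ) / 2))
  refine (h2.congr_of_eventuallyEq (Filter.Eventually.of_forall fun y => ?_)).congr_fderiv ?_
  · simp only [density, Pi.neg_apply]; congr 2; ring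
  · ext v
    simp [density]
    ring_nf

/-- Gaussian integration by parts. -/
lemma integral_mul_coord {g : Euc n → ℝ} (hg : Differentiable ℝ g) {C C' : ℝ}
    (hC : ∀ x, |g x| ≤ C) (v : Euc n) (hC' : ∀ x, |fderiv ℝ g x v| ≤ C') :
    ∫ x, inner ℝ x v * g x ∂(gauss n) = ∫ x, fderiv ℝ g x v ∂(gauss n) := by
  rw [integral_gauss, integral_gauss]
  have hd : ∀ x : Euc n, fderiv ℝ (density n) x v = -(density n x * inner ℝ x v) := by
    intro x; rw [(hasFDerivAt_density x).fderiv]; simp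
  have hint : Integrable (fun x => inner ℝ x v * g x) (gauss n) := by
    refine integrable_of_bound_mul (A := 0) (C := ‖v‖ * C)
      (by have := hg.continuous; fun_prop) fun x => ?_
    rw [abs_mul, zero_add]
    have h1 := abs_real_inner_le_norm x v
    have h2 := hC x
    calc |inner ℝ x v| * |g x| ≤ (‖x‖ * ‖v‖) * C := by gcongr
      _ = _ := by ring
  have h := integral_mul_fderiv_eq_neg_fderiv_mul_of_integrable (𝕜 := ℝ) (μ := volume)
    (f := density n) (g := g) (v := v) ?_ ?_ ?_
    (fun x _ => (hasFDerivAt_density x).differentiableAt) (fun x _ => hg x)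
  · rw [h, ← integral_neg]
    congr 1; ext x; rw [hd]; ring
  · rw [integrable_gauss_iff] at hint
    refine hint.neg.congr (Filter.Eventually.of_forall fun x => ?_)
    simp only [hd, Pi.neg_apply]; ring
  · rw [← integrable_gauss_iff]
    exact integrable_of_bound (measurable_fderiv_apply_const ℝ g v).aestronglyMeasurable hC'
  · rw [← integrable_gauss_iff]
    exact integrable_of_bound hg.continuous.aestronglyMeasurable hC

/-- Smooth functions all of whose derivatives are bounded. -/
def Nice (g : Euc n → ℝ) : Prop :=
  ContDiff ℝ (⊤ : ℕ∞) g ∧ ∀ k : ℕ, ∃ C : ℝ, ∀ x, ‖iteratedFDeriv ℝ k g x‖ ≤ C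

/-- The `i`-th partial derivative. -/
noncomputable def pd (i : Fin n) (g : Euc n → ℝ) (x : Euc n) : ℝ :=
  fderiv ℝ g x (EuclideanSpace.single i 1)

lemma Nice.pd {g : Euc n → ℝ} (hg : Nice g) (i : Fin n) : Nice (pd i g) := by
  have h1 : ContDiff ℝ (⊤ : ℕ∞) (fderiv ℝ g) :=
    hg.1.fderiv_right (by simp)
  refine ⟨h1.clm_apply contDiff_const, fun k => ?_⟩
  obtain ⟨C, hC⟩ := hg.2 (k + 1)
  refine ⟨‖(EuclideanSpace.single i 1 : Euc n)‖ * C, fun x => ?_⟩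
  refine (norm_iteratedFDeriv_clm_apply_const (N := (⊤ : ℕ∞)) h1.contDiffAt
    (by exact_mod_cast le_top)).trans ?_
  rw [norm_iteratedFDeriv_fderiv]
  gcongr
  exact hC x

lemma Nice.differentiable {g : Euc n → ℝ} (hg : Nice g) : Differentiable ℝ g :=
  hg.1.differentiable (by simp)

lemma Nice.continuous {g : Euc n → ℝ} (hg : Nice g) : Continuous g := hg.1.continuous

lemma Nice.continuous_fderiv {g : Euc n → ℝ} (hg : Nice g) : Continuous (fderiv ℝ g) :=
  hg.1.continuous_fderiv (by simp)

lemma Nice.bound {g : Euc n → ℝ} (hg : Nice g) : ∃ C, ∀ x, |g x| ≤ C := by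
  obtain ⟨C, hC⟩ := hg.2 0
  exact ⟨C, fun x => by simpa using hC x⟩

lemma Nice.bound_fderiv {g : Euc n → ℝ} (hg : Nice g) : ∃ C, ∀ x, ‖fderiv ℝ g x‖ ≤ C := by
  obtain ⟨C, hC⟩ := hg.2 1
  refine ⟨C, fun x => ?_⟩
  have := hC x
  rwa [← norm_iteratedFDeriv_fderiv, norm_iteratedFDeriv_zero] at this

lemma Nice.const_mul {g : Euc n → ℝ} (hg : Nice g) (c : ℝ) : Nice (fun x => c * g x) := by
  refine ⟨contDiff_const.mul hg.1, fun k => ?_⟩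
  obtain ⟨C, hC⟩ := hg.2 k
  refine ⟨|c| * C, fun x => ?_⟩
  have := iteratedFDeriv_const_smul_apply (𝕜 := ℝ) (a := c) (f := g) (x := x) (i := k)
    (hg.1.contDiffAt.of_le (by exact_mod_cast le_top))
  have h2 : (fun x => c * g x) = c • g := rfl
  rw [h2, this, norm_smul, Real.norm_eq_abs]
  gcongr
  exact hC x

lemma fderiv_apply_eq_sum (g : Euc n → ℝ) (x v : Euc n) :
    fderiv ℝ g x v = ∑ i, v i * pd i g x := by
  have h : v = ∑ i, v i • (EuclideanSpace.single i (1 : ℝ) : Euc n) := by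
    ext j
    simp [Finset.sum_apply, Pi.single_apply]
  conv_lhs => rw [h]
  simp [pd]

lemma norm_fderiv_sq (g : Euc n → ℝ) (x : Euc n) :
    ‖fderiv ℝ g x‖ ^ 2 = ∑ i, pd i g x ^ 2 := by
  let w : Euc n := (InnerProductSpace.toDual ℝ (Euc n)).symm (fderiv ℝ g x)
  have h1 : ‖fderiv ℝ g x‖ = ‖w‖ := by simp [w]
  have h2 : ∀ i, w i = pd i g x := by
    intro i
    have : inner ℝ w (EuclideanSpace.single i (1 : ℝ)) = pd i g x := by
      simp only [w, InnerProductSpace.toDual_symm_apply, pd]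
    rw [← this, EuclideanSpace.inner_single_right]
    simp
  rw [h1, EuclideanSpace.norm_sq_eq]
  simp [h2]

/-- The Ornstein–Uhlenbeck semigroup, with time parametrised by `[0, 1]`. -/
noncomputable def ou (s : ℝ) (g : Euc n → ℝ) (z : Euc n) : ℝ :=
  ∫ y, g (√s • z + √(1 - s) • y) ∂(gauss n)

lemma ou_zero (g : Euc n → ℝ) (z : Euc n) : ou 0 g z = ∫ y, g y ∂(gauss n) := by
  simp [ou]

lemma ou_one (g : Euc n → ℝ) (z : Euc n) : ou 1 g z = g z := by
  simp [ou]

lemma abs_ou_le {g : Euc n → ℝ} {C : ℝ} (hC : ∀ x, |g x| ≤ C) (s : ℝ) (z : Euc n) :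
    |ou s g z| ≤ C := by
  have h := norm_integral_le_of_norm_le_const (μ := gauss n)
    (f := fun y => g (√s • z + √(1 - s) • y)) (C := C) (Filter.Eventually.of_forall fun x => hC _)
  simpa [ou] using h

lemma continuous_ou {g : Euc n → ℝ} (hg : Nice g) :
    Continuous (fun p : ℝ × Euc n => ou p.1 g p.2) := by
  obtain ⟨C, hC⟩ := hg.bound
  have hc := hg.continuous
  refine continuous_of_dominated (bound := fun _ => C) (fun p => ?_)
    (fun p => Filter.Eventually.of_forall fun y => hC _) (integrable_const C)
    (Filter.Eventually.of_forall fun y => ?_)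
  · exact Continuous.aestronglyMeasurable (by fun_prop)
  · fun_prop

lemma hasFDerivAt_ou {g : Euc n → ℝ} (hg : Nice g) (s : ℝ) (z : Euc n) :
    HasFDerivAt (ou s g)
      (∑ i, (√s * ou s (pd i g) z) • (EuclideanSpace.proj i : Euc n →L[ℝ] ℝ)) z := by
  obtain ⟨C, hC⟩ := hg.bound
  obtain ⟨C', hC'⟩ := hg.bound_fderiv
  have hc := hg.continuous
  have hc' := hg.continuous_fderiv
  have hint : Integrable (fun y => √s • fderiv ℝ g (√s • z + √(1 - s) • y)) (gauss n) := by
    refine (integrable_const (√s * C')).mono' (Continuous.aestronglyMeasurable (by fun_prop))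
      (Filter.Eventually.of_forall fun y => ?_)
    rw [norm_smul, Real.norm_of_nonneg (sqrt_nonneg s)]
    gcongr
    exact hC' _
  have h := hasFDerivAt_integral_of_dominated_of_fderiv_le (𝕜 := ℝ) (μ := gauss n)
    (F := fun z y => g (√s • z + √(1 - s) • y))
    (F' := fun z y => √s • fderiv ℝ g (√s • z + √(1 - s) • y)) (x₀ := z)
    (bound := fun _ => √s * C') Filter.univ_mem
    (Filter.Eventually.of_forall fun z => Continuous.aestronglyMeasurable (by fun_prop))
    (integrable_of_bound (Continuous.aestronglyMeasurable (by fun_prop)) fun y => hC _)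
    (Continuous.aestronglyMeasurable (by fun_prop))
    (Filter.Eventually.of_forall fun y z _ => by
      rw [norm_smul, Real.norm_of_nonneg (sqrt_nonneg s)]
      gcongr
      exact hC' _) (integrable_const _)
    (Filter.Eventually.of_forall fun y z _ => by
      have h1 : HasFDerivAt (fun z : Euc n => √s • z + √(1 - s) • y)
          (√s • ContinuousLinearMap.id ℝ (Euc n)) z :=
        ((hasFDerivAt_id z).const_smul (√s)).add_const _
      refine ((hg.differentiable _).hasFDerivAt.comp z h1).congr_fderiv ?_
      ext v; simp)
  refine h.congr_fderiv ?_
  ext v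
  rw [ContinuousLinearMap.integral_apply hint]
  simp only [smul_apply, fderiv_apply_eq_sum, sum_apply,
    smul_eq_mul, PiLp.proj_apply]
  rw [integral_const_mul, integral_finsetSum, Finset.mul_sum]
  · refine Finset.sum_congr rfl fun i _ => ?_
    rw [integral_const_mul]
    simp only [ou]; ring
  · intro i _
    obtain ⟨Ci, hCi⟩ := (hg.pd i).bound
    have := (hg.pd i).continuous
    exact (integrable_of_bound (Continuous.aestronglyMeasurable (by fun_prop))
      fun y => hCi _).const_mul _

lemma fderiv_ou_single {g : Euc n → ℝ} (hg : Nice g) (s : ℝ) (z : Euc n) (i : Fin n) :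
    fderiv ℝ (ou s g) z (EuclideanSpace.single i 1) = √s * ou s (pd i g) z := by
  rw [(hasFDerivAt_ou hg s z).fderiv]
  simp

lemma hasDerivAt_ou {g : Euc n → ℝ} (hg : Nice g) {s : ℝ} (hs : s ∈ Set.Ioo (0 : ℝ) 1)
    (z : Euc n) :
    HasDerivAt (fun s => ou s g z)
      (1 / 2 * ((√s)⁻¹ * ∑ i, z i * ou s (pd i g) z - ∑ i, ou s (pd i (pd i g)) z)) s := by
  obtain ⟨C, hC⟩ := hg.bound
  obtain ⟨C', hC'⟩ := hg.bound_fderiv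
  have hC'0 : 0 ≤ C' := (norm_nonneg _).trans (hC' 0)
  have hc := hg.continuous
  have hc' := hg.continuous_fderiv
  have hs0 := hs.1
  have hs1 := hs.2
  have h := (hasDerivAt_integral_of_dominated_loc_of_deriv_le (𝕜 := ℝ) (μ := gauss n)
    (F := fun s y => g (√s • z + √(1 - s) • y))
    (F' := fun s y => fderiv ℝ g (√s • z + √(1 - s) • y)
      ((1 / (2 * √s)) • z + (-1 / (2 * √(1 - s))) • y)) (x₀ := s)
    (s := Set.Ioo (s / 2) ((1 + s) / 2))
    (bound := fun y => C' * (1 / (2 * √(s / 2)) * ‖z‖ + 1 / (2 * √((1 - s) / 2)) * ‖y‖))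
    (Ioo_mem_nhds (by linarith) (by linarith))
    (Filter.Eventually.of_forall fun z => Continuous.aestronglyMeasurable (by fun_prop))
    (integrable_of_bound (Continuous.aestronglyMeasurable (by fun_prop)) fun y => hC _)
    (Continuous.aestronglyMeasurable (by fun_prop))
    (Filter.Eventually.of_forall fun y t ht => by
      have h1 : √(s / 2) ≤ √t := sqrt_le_sqrt ht.1.le
      have h2 : √((1 - s) / 2) ≤ √(1 - t) := sqrt_le_sqrt (by linarith [ht.2])
      have h3 : 0 < √(s / 2) := sqrt_pos.2 (by linarith)
      have h4 : 0 < √((1 - s) / 2) := sqrt_pos.2 (by linarith)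
      refine (ContinuousLinearMap.le_opNorm _ _).trans ?_
      gcongr
      · exact hC' _
      · refine (norm_add_le _ _).trans ?_
        rw [norm_smul, norm_smul, Real.norm_eq_abs, Real.norm_eq_abs, abs_div, abs_div, abs_neg,
          abs_one, abs_of_pos (by linarith : 0 < 2 * √t),
          abs_of_pos (by linarith : 0 < 2 * √(1 - t))]
        gcongr)
    (((integrable_const _).add (integrable_norm_gauss.const_mul _)).const_mul _)
    (Filter.Eventually.of_forall fun y t ht => by
      have ht0 : t ≠ 0 := by linarith [ht.1]
      have ht1 : 1 - t ≠ 0 := by linarith [ht.2]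
      have h1 : HasDerivAt (fun t : ℝ => √t • z + √(1 - t) • y)
          ((1 / (2 * √t)) • z + (-1 / (2 * √(1 - t))) • y) t :=
        ((hasDerivAt_sqrt ht0).smul_const z).add
          ((((hasDerivAt_id t).const_sub 1).sqrt ht1).smul_const y)
      exact (hg.differentiable _).hasFDerivAt.comp_hasDerivAt t h1)).2
  refine h.congr_deriv ?_
  simp only [map_add, map_smul, smul_eq_mul]
  have hi : ∀ g' : Euc n → ℝ, Nice g' →
      Integrable (fun y => g' (√s • z + √(1 - s) • y)) (gauss n) := by
    intro g' hg'
    obtain ⟨Ci, hCi⟩ := hg'.bound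
    have := hg'.continuous
    exact integrable_of_bound (Continuous.aestronglyMeasurable (by fun_prop)) fun y => hCi _
  have hi2 : ∀ i : Fin n, Integrable (fun y : Euc n => y i * pd i g (√s • z + √(1 - s) • y))
      (gauss n) := by
    intro i
    obtain ⟨Ci, hCi⟩ := (hg.pd i).bound
    have := (hg.pd i).continuous
    refine integrable_of_bound_mul (A := 0) (C := Ci)
      (Continuous.aestronglyMeasurable (by fun_prop)) fun y => ?_
    rw [abs_mul, zero_add, mul_comm]
    gcongr
    · exact (abs_nonneg _).trans (hCi 0)
    · exact hCi _
    · exact PiLp.norm_apply_le y i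
  have hibp : ∀ i : Fin n, ∫ y, y i * pd i g (√s • z + √(1 - s) • y) ∂(gauss n)
      = √(1 - s) * ou s (pd i (pd i g)) z := by
    intro i
    obtain ⟨Ci, hCi⟩ := (hg.pd i).bound
    obtain ⟨Cii, hCii⟩ := ((hg.pd i).pd i).bound
    have hfd : ∀ y : Euc n, HasFDerivAt (fun y => pd i g (√s • z + √(1 - s) • y))
        (√(1 - s) • fderiv ℝ (pd i g) (√s • z + √(1 - s) • y)) y := by
      intro y
      have h1 : HasFDerivAt (fun y : Euc n => √s • z + √(1 - s) • y)
          (√(1 - s) • ContinuousLinearMap.id ℝ (Euc n)) y :=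
        ((hasFDerivAt_id y).const_smul (√(1 - s))).const_add _
      refine (((hg.pd i).differentiable _).hasFDerivAt.comp y h1).congr_fderiv ?_
      ext v; simp
    have hval : ∀ y : Euc n, fderiv ℝ (fun y => pd i g (√s • z + √(1 - s) • y)) y
        (EuclideanSpace.single i 1) = √(1 - s) * pd i (pd i g) (√s • z + √(1 - s) • y) := by
      intro y
      rw [(hfd y).fderiv]; rfl
    have h := integral_mul_coord (g := fun y => pd i g (√s • z + √(1 - s) • y))
      (fun y => (hfd y).differentiableAt) (fun y => hCi _) (EuclideanSpace.single i 1)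
      (C' := √(1 - s) * Cii) (fun y => by
        rw [hval, abs_mul, abs_of_nonneg (sqrt_nonneg _)]
        gcongr
        exact hCii _)
    simp only [hval, EuclideanSpace.inner_single_right] at h
    simp only [one_mul, conj_trivial] at h
    rw [h, integral_const_mul, ou]
  have hsum1 : ∫ y, fderiv ℝ g (√s • z + √(1 - s) • y) z ∂(gauss n)
      = ∑ i, z i * ou s (pd i g) z := by
    simp only [fderiv_apply_eq_sum]
    rw [integral_finsetSum _ fun i _ => (hi _ (hg.pd i)).const_mul _]
    exact Finset.sum_congr rfl fun i _ => by rw [integral_const_mul, ou]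
  have hsum2 : ∫ y, fderiv ℝ g (√s • z + √(1 - s) • y) y ∂(gauss n)
      = √(1 - s) * ∑ i, ou s (pd i (pd i g)) z := by
    simp only [fderiv_apply_eq_sum]
    rw [integral_finsetSum _ fun i _ => hi2 i, Finset.mul_sum]
    exact Finset.sum_congr rfl fun i _ => hibp i
  rw [integral_add, integral_const_mul, integral_const_mul, hsum1, hsum2]
  · have h3 : √s ≠ 0 := (sqrt_pos.2 hs0).ne'
    have h4 : √(1 - s) ≠ 0 := (sqrt_pos.2 (by linarith)).ne'
    field_simp
    ring
  · refine Integrable.const_mul ?_ _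
    simp only [fderiv_apply_eq_sum]
    exact integrable_finsetSum _ fun i _ => (hi _ (hg.pd i)).const_mul _
  · refine Integrable.const_mul ?_ _
    simp only [fderiv_apply_eq_sum]
    exact integrable_finsetSum _ fun i _ => hi2 i

open Filter Topology

/-- The nonnegative solution `t` of `t * (exp t - x ^ 2) = w`, for `x ^ 2 < 1` and `0 ≤ w`. -/
noncomputable def root (x w : ℝ) : ℝ :=
  Classical.epsilon fun t => 0 ≤ t ∧ t * (Real.exp t - x ^ 2) = w

lemma root_spec {x w : ℝ} (hx : x ^ 2 < 1) (hw : 0 ≤ w) :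
    0 ≤ root x w ∧ root x w * (Real.exp (root x w) - x ^ 2) = w := by
  refine Classical.epsilon_spec (p := fun t => 0 ≤ t ∧ t * (Real.exp t - x ^ 2) = w) ?_
  have hc : ContinuousOn (fun t : ℝ => t * (Real.exp t - x ^ 2)) (Set.Icc 0 (1 + w)) := by
    fun_prop
  have h := intermediate_value_Icc (by linarith : (0 : ℝ) ≤ 1 + w) hc
  have h2 : w ∈ Set.Icc ((0 : ℝ) * (Real.exp 0 - x ^ 2))
      ((1 + w) * (Real.exp (1 + w) - x ^ 2)) := by
    constructor
    · simpa using hw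
    · nlinarith [Real.add_one_le_exp (1 + w)]
  obtain ⟨t, ht, hte⟩ := h h2
  exact ⟨t, ht.1, hte⟩

/-- The slope of `t ↦ t * exp t`. -/
noncomputable def expSlope (a t : ℝ) : ℝ := dslope (fun t => t * Real.exp t) a t

lemma sub_mul_expSlope (a t : ℝ) :
    (t - a) * expSlope a t = t * Real.exp t - a * Real.exp a := by
  exact sub_smul_dslope (fun t => t * Real.exp t) a t

lemma hasDerivAt_mul_exp (a : ℝ) :
    HasDerivAt (fun t => t * Real.exp t) (Real.exp a * (1 + a)) a := by
  refine ((hasDerivAt_id a).mul (Real.hasDerivAt_exp a)).congr_deriv ?_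
  simp; ring

lemma expSlope_self (a : ℝ) : expSlope a a = Real.exp a * (1 + a) := by
  rw [expSlope, dslope_same, (hasDerivAt_mul_exp a).deriv]

lemma continuousAt_expSlope (a : ℝ) : ContinuousAt (expSlope a) a :=
  continuousAt_dslope_same.2 (hasDerivAt_mul_exp a).differentiableAt

lemma mul_exp_sub_le {a t : ℝ} (ha : 0 ≤ a) (hat : a ≤ t) :
    t - a ≤ t * Real.exp t - a * Real.exp a := by
  have h1 : 1 ≤ Real.exp a := Real.one_le_exp ha
  have h2 : Real.exp a ≤ Real.exp t := Real.exp_le_exp.2 hat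
  nlinarith

lemma one_le_expSlope {a t : ℝ} (ha : 0 ≤ a) (ht : 0 ≤ t) : 1 ≤ expSlope a t := by
  have h := sub_mul_expSlope a t
  rcases lt_trichotomy a t with hat | hat | hat
  · have := mul_exp_sub_le ha hat.le
    by_contra! hlt
    nlinarith
  · rw [← hat, expSlope_self]
    nlinarith [Real.one_le_exp ha]
  · have := mul_exp_sub_le ht hat.le
    by_contra! hlt
    nlinarith

/-- The exact increment formula for solutions of `t * (exp t - x ^ 2) = w`. -/
lemma sub_mul_expSlope_sub {x w t x₀ w₀ t₀ : ℝ} (h : t * (Real.exp t - x ^ 2) = w)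
    (h₀ : t₀ * (Real.exp t₀ - x₀ ^ 2) = w₀) :
    (t - t₀) * (expSlope t₀ t - x ^ 2) = w - w₀ + t₀ * (x ^ 2 - x₀ ^ 2) := by
  have := sub_mul_expSlope t₀ t
  rw [mul_sub, this, ← h, ← h₀]; ring

lemma root_unique {x w t : ℝ} (hx : x ^ 2 < 1) (ht : 0 ≤ t)
    (h : t * (Real.exp t - x ^ 2) = w) : root x w = t := by
  have hw : 0 ≤ w := by
    rw [← h]; exact mul_nonneg ht (by nlinarith [Real.one_le_exp ht])
  obtain ⟨h1, h2⟩ := root_spec hx hw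
  have h3 := sub_mul_expSlope_sub h2 h
  have h4 := one_le_expSlope ht h1
  have h5 : (root x w - t) * (expSlope t (root x w) - x ^ 2) = 0 := by rw [h3]; ring
  rcases mul_eq_zero.1 h5 with h6 | h6 <;> linarith

lemma root_zero {x : ℝ} (hx : x ^ 2 < 1) : root x 0 = 0 :=
  root_unique hx le_rfl (by simp)

lemma root_le {x w : ℝ} (hx : x ^ 2 < 1) (hw : 0 ≤ w) : root x w ≤ 1 + w := by
  obtain ⟨h1, h2⟩ := root_spec hx hw
  nlinarith [Real.add_one_le_exp (root x w)]

lemma one_sub_le {x w : ℝ} (hx : x ^ 2 < 1) (hw : 0 ≤ w) :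
    1 - x ^ 2 ≤ Real.exp (root x w) - x ^ 2 := by
  have := Real.one_le_exp (root_spec hx hw).1
  linarith

lemma tendsto_root {α : Type*} {l : Filter α} {U W : α → ℝ} {x w : ℝ} (hx : x ^ 2 < 1)
    (hw : 0 ≤ w) (hU : Tendsto U l (𝓝 x)) (hW : Tendsto W l (𝓝 w)) (hW0 : ∀ᶠ y in l, 0 ≤ W y) :
    Tendsto (fun y => root (U y) (W y)) l (𝓝 (root x w)) := by
  obtain ⟨h1, h2⟩ := root_spec hx hw
  have hU1 : ∀ᶠ y in l, U y ^ 2 < 1 := (hU.pow 2).eventually_lt_const hx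
  have hlim : Tendsto (fun y => |W y - w + root x w * (U y ^ 2 - x ^ 2)| / (1 - U y ^ 2)) l
      (𝓝 0) := by
    have h := (((hW.sub_const w).add (((hU.pow 2).sub_const (x ^ 2)).const_mul (root x w))).abs).div
      ((hU.pow 2).const_sub 1) (by linarith : 1 - x ^ 2 ≠ 0)
    simpa [Pi.div_def] using h
  rw [tendsto_iff_norm_sub_tendsto_zero]
  refine squeeze_zero' (Eventually.of_forall fun y => norm_nonneg _) ?_ hlim
  filter_upwards [hU1, hW0] with y hy1 hy2
  obtain ⟨h3, h4⟩ := root_spec hy1 hy2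
  have h5 := sub_mul_expSlope_sub h4 h2
  have h6 := one_le_expSlope h1 h3
  rw [le_div_iff₀ (by linarith), ← h5, abs_mul, Real.norm_eq_abs]
  gcongr
  rw [abs_of_nonneg (by linarith)]
  linarith

section Deriv

variable {F : Type*} [NormedAddCommGroup F] [NormedSpace ℝ F]

lemma HasFDerivAt.mul_of_eq_zero {k h : F → ℝ} {h' : F →L[ℝ] ℝ} {y : F} (hk : ContinuousAt k y)
    (hh : HasFDerivAt h h' y) (h0 : h y = 0) : HasFDerivAt (fun z => k z * h z) (k y • h') y := by
  have h1 : HasFDerivAt (fun z => k y * h z) (k y • h') y := hh.const_mul (k y)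
  have h2 : HasFDerivAt (fun z => (k z - k y) * h z) (0 : F →L[ℝ] ℝ) y := by
    rw [hasFDerivAt_iff_isLittleO]
    simp only [h0, mul_zero, sub_zero, zero_apply]
    have h3 : (fun z => k z - k y) =o[𝓝 y] (fun _ => (1 : ℝ)) := by
      rw [Asymptotics.isLittleO_one_iff]
      simpa using hk.tendsto.sub_const (k y)
    have h4 : h =O[𝓝 y] fun z => z - y := by
      simpa [h0] using hh.isBigO_sub
    have h5 := (h3.mul_isBigO h4.norm_right)
    simp only [one_mul] at h5
    exact h5.of_norm_right
  refine ((h1.add h2).congr_of_eventuallyEq (Eventually.of_forall fun z => ?_)).congr_fderiv ?_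
  · simp only [Pi.add_apply]; ring
  · simp

variable {U W : F → ℝ} {U' W' : F →L[ℝ] ℝ} {y : F}

lemma hasFDerivAt_root (hU : HasFDerivAt U U' y) (hW : HasFDerivAt W W' y) (hx : U y ^ 2 < 1)
    (hW0 : ∀ᶠ z in 𝓝 y, 0 ≤ W z) :
    HasFDerivAt (fun z => root (U z) (W z))
      ((Real.exp (root (U y) (W y)) * (1 + root (U y) (W y)) - U y ^ 2)⁻¹ •
        (W' + (2 * root (U y) (W y) * U y) • U')) y := by
  have hw := hW0.self_of_nhds
  obtain ⟨h1, h2⟩ := root_spec hx hw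
  have hU1 : ∀ᶠ z in 𝓝 y, U z ^ 2 < 1 := (hU.continuousAt.tendsto.pow 2).eventually_lt_const hx
  have hR := tendsto_root hx hw hU.continuousAt hW.continuousAt hW0
  set r := root (U y) (W y) with hr
  have hne : expSlope r r - U y ^ 2 ≠ 0 := by
    have := one_le_expSlope h1 h1
    linarith
  have hk : ContinuousAt (fun z => (expSlope r (root (U z) (W z)) - U z ^ 2)⁻¹) y := by
    have h3 : Tendsto (fun z => expSlope r (root (U z) (W z))) (𝓝 y) (𝓝 (expSlope r r)) :=
      (continuousAt_expSlope r).tendsto.comp hR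
    exact (h3.sub (hU.continuousAt.tendsto.pow 2)).inv₀ hne
  have hh : HasFDerivAt (fun z => W z - W y + r * (U z ^ 2 - U y ^ 2))
      (W' + (2 * r * U y) • U') y := by
    refine ((hW.sub_const (W y)).add (((hU.pow 2).sub_const (U y ^ 2)).const_mul r)).congr_fderiv ?_
    ext v; simp; ring
  have h := (HasFDerivAt.mul_of_eq_zero hk hh (by simp)).add_const r
  rw [← hr, expSlope_self] at h
  refine h.congr_of_eventuallyEq ?_
  filter_upwards [hU1, hW0] with z hz1 hz2
  obtain ⟨h3, h4⟩ := root_spec hz1 hz2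
  have h5 := sub_mul_expSlope_sub h4 h2
  have h6 := one_le_expSlope h1 h3
  have h7 : expSlope r (root (U z) (W z)) - U z ^ 2 ≠ 0 := by linarith
  rw [← h5]
  field_simp
  ring

end Deriv

/-- The integrand, as a function of `f` and `r`. -/
noncomputable def integrand (x t : ℝ) : ℝ :=
  x * Real.arccos (-x * Real.exp (-t / 2)) + (1 - t) * √(Real.exp t - x ^ 2)

/-- The integrand, as a function of `f` and `‖∇f‖ ^ 2`. -/
noncomputable def bellman (x w : ℝ) : ℝ := integrand x (root x w)

/-- The square root appearing in the derivatives of `bellman`. -/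
noncomputable def sq (x w : ℝ) : ℝ := √(Real.exp (root x w) - x ^ 2)

/-- The denominator in the derivatives of `root`. -/
noncomputable def den (x w : ℝ) : ℝ := Real.exp (root x w) * (1 + root x w) - x ^ 2

/-- The partial derivative of `bellman` in the first variable. -/
noncomputable def bx (x w : ℝ) : ℝ := Real.arccos (-x * Real.exp (-root x w / 2))

/-- The partial derivative of `bellman` in the second variable. -/
noncomputable def bw (x w : ℝ) : ℝ := -1 / (2 * sq x w)

/-- The second partial derivative of `bellman` in the first variable. -/
noncomputable def bxx (x w : ℝ) : ℝ := sq x w * (1 + root x w) / den x w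

/-- The mixed second partial derivative of `bellman`. -/
noncomputable def bxw (x w : ℝ) : ℝ := -x / (2 * sq x w * den x w)

/-- The second partial derivative of `bellman` in the second variable. -/
noncomputable def bww (x w : ℝ) : ℝ := Real.exp (root x w) / (4 * sq x w ^ 3 * den x w)

lemma sq_eq (x w : ℝ) : √(Real.exp (root x w) - x ^ 2) = sq x w := rfl

lemma den_eq (x w : ℝ) : Real.exp (root x w) * (1 + root x w) - x ^ 2 = den x w := rfl

lemma sq_pos {x w : ℝ} (hx : x ^ 2 < 1) (hw : 0 ≤ w) : 0 < sq x w :=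
  sqrt_pos.2 (by linarith [one_sub_le hx hw])

lemma sq_sq {x w : ℝ} (hx : x ^ 2 < 1) (hw : 0 ≤ w) :
    sq x w ^ 2 = Real.exp (root x w) - x ^ 2 :=
  Real.sq_sqrt (by linarith [one_sub_le hx hw])

lemma den_pos {x w : ℝ} (hx : x ^ 2 < 1) (hw : 0 ≤ w) : 0 < den x w := by
  have h1 := one_sub_le hx hw
  have h2 := (root_spec hx hw).1
  have h3 := mul_nonneg (Real.exp_pos (root x w)).le h2
  unfold den
  linarith

section Deriv

variable {F : Type*} [NormedAddCommGroup F] [NormedSpace ℝ F]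
variable {U W : F → ℝ} {U' W' : F →L[ℝ] ℝ} {y : F}

lemma hasFDerivAt_sq (hU : HasFDerivAt U U' y) (hW : HasFDerivAt W W' y) (hx : U y ^ 2 < 1)
    (hW0 : ∀ᶠ z in 𝓝 y, 0 ≤ W z) :
    HasFDerivAt (fun z => sq (U z) (W z))
      ((-U y * sq (U y) (W y) / den (U y) (W y)) • U' +
        (Real.exp (root (U y) (W y)) / (2 * sq (U y) (W y) * den (U y) (W y))) • W') y := by
  have hw := hW0.self_of_nhds
  have hS := sq_pos hx hw
  have hD := den_pos hx hw
  have hS2 := sq_sq hx hw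
  have hR := hasFDerivAt_root hU hW hx hW0
  have h := (hR.exp.sub (hU.pow 2)).sqrt (by simpa [hS2] using (pow_pos hS 2).ne')
  refine h.congr_fderiv ?_
  ext v
  have hd : den (U y) (W y) = sq (U y) (W y) ^ 2
      + root (U y) (W y) * Real.exp (root (U y) (W y)) := by
    rw [hS2, den]; ring
  simp [den_eq, sq_eq]
  field_simp
  rw [hd]
  ring_nf

lemma hasFDerivAt_bw (hU : HasFDerivAt U U' y) (hW : HasFDerivAt W W' y) (hx : U y ^ 2 < 1)
    (hW0 : ∀ᶠ z in 𝓝 y, 0 ≤ W z) :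
    HasFDerivAt (fun z => bw (U z) (W z))
      (bxw (U y) (W y) • U' + bww (U y) (W y) • W') y := by
  have hw := hW0.self_of_nhds
  have hS := sq_pos hx hw
  have hD := den_pos hx hw
  have h1 : HasDerivAt (fun t : ℝ => -1 / (2 * t)) (1 / (2 * sq (U y) (W y) ^ 2))
      (sq (U y) (W y)) := by
    have := ((hasDerivAt_inv hS.ne').const_mul (-1 / 2))
    refine (this.congr_of_eventuallyEq (Eventually.of_forall fun t => ?_)).congr_deriv ?_
    · simp only; field_simp
    · field_simp
  refine (h1.comp_hasFDerivAt y (hasFDerivAt_sq hU hW hx hW0)).congr_fderiv ?_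
  ext v
  simp [bxw, bww]
  field_simp
  ring

lemma hasFDerivAt_bx (hU : HasFDerivAt U U' y) (hW : HasFDerivAt W W' y) (hx : U y ^ 2 < 1)
    (hW0 : ∀ᶠ z in 𝓝 y, 0 ≤ W z) :
    HasFDerivAt (fun z => bx (U z) (W z))
      (bxx (U y) (W y) • U' + bxw (U y) (W y) • W') y := by
  have hw := hW0.self_of_nhds
  have hS := sq_pos hx hw
  have hD := den_pos hx hw
  have hS2 := sq_sq hx hw
  have hR := hasFDerivAt_root hU hW hx hW0
  have hE : HasFDerivAt (fun z => -U z * Real.exp (-root (U z) (W z) / 2)) _ y :=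
    hU.neg.mul ((hR.neg.mul_const (1 / 2)).exp.congr_of_eventuallyEq
      (Eventually.of_forall fun z => by simp only [Pi.neg_apply]; congr 1; ring))
  have hroot : √(1 - (-U y * Real.exp (-root (U y) (W y) / 2)) ^ 2)
      = sq (U y) (W y) * Real.exp (-root (U y) (W y) / 2) := by
    rw [show 1 - (-U y * Real.exp (-root (U y) (W y) / 2)) ^ 2
      = (sq (U y) (W y) * Real.exp (-root (U y) (W y) / 2)) ^ 2 from ?_]
    · exact Real.sqrt_sq (by positivity)
    · rw [mul_pow, mul_pow, hS2, ← Real.exp_nat_mul, sub_mul, ← Real.exp_add]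
      rw [show root (U y) (W y) + ((2 : ℕ) : ℝ) * (-root (U y) (W y) / 2) = 0 by push_cast; ring]
      simp
  have hlt : (-U y * Real.exp (-root (U y) (W y) / 2)) ^ 2 < 1 := by
    have : 0 < √(1 - (-U y * Real.exp (-root (U y) (W y) / 2)) ^ 2) := by
      rw [hroot]; positivity
    linarith [sqrt_pos.1 this]
  have h := (Real.hasDerivAt_arccos (by nlinarith) (by nlinarith)).comp_hasFDerivAt y hE
  refine h.congr_fderiv ?_
  rw [hroot]
  have hd : den (U y) (W y) = sq (U y) (W y) ^ 2
      + root (U y) (W y) * Real.exp (root (U y) (W y)) := by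
    rw [hS2, den]; ring
  have hy : U y ^ 2 = Real.exp (root (U y) (W y)) - sq (U y) (W y) ^ 2 := by rw [hS2]; ring
  have hexp : Real.exp (-(root (U y) (W y) * 2⁻¹)) = Real.exp (-root (U y) (W y) / 2) := by
    congr 1; ring
  ext v
  simp [den_eq, bxx, bxw, hexp]
  field_simp
  ring_nf
  simp only [hy]
  rw [hd]
  ring

lemma hasFDerivAt_bellman (hU : HasFDerivAt U U' y) (hW : HasFDerivAt W W' y) (hx : U y ^ 2 < 1)
    (hW0 : ∀ᶠ z in 𝓝 y, 0 ≤ W z) :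
    HasFDerivAt (fun z => bellman (U z) (W z))
      (bx (U y) (W y) • U' + bw (U y) (W y) • W') y := by
  have hw := hW0.self_of_nhds
  have hS := sq_pos hx hw
  have hD := den_pos hx hw
  have hS2 := sq_sq hx hw
  have hR := hasFDerivAt_root hU hW hx hW0
  have h := (hU.mul (hasFDerivAt_bx hU hW hx hW0)).add
    ((hR.const_sub 1).mul (hasFDerivAt_sq hU hW hx hW0))
  refine h.congr_fderiv ?_
  have hd : den (U y) (W y) = sq (U y) (W y) ^ 2
      + root (U y) (W y) * Real.exp (root (U y) (W y)) := by
    rw [hS2, den]; ring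
  have hy : U y ^ 2 = Real.exp (root (U y) (W y)) - sq (U y) (W y) ^ 2 := by rw [hS2]; ring
  ext v
  simp [den_eq, bxx, bxw, bw]
  field_simp
  ring_nf
  rw [hy, hd]
  ring

end Deriv

/-- The pointwise inequality behind the monotonicity along the semigroup. -/
lemma quad_nonpos {x w : ℝ} (hx : x ^ 2 < 1) (hw : 0 ≤ w) {a T b : ℝ} (hb0 : 0 ≤ b)
    (hT : T ^ 2 ≤ 4 * w * b) :
    bxx x w * a ^ 2 + 2 * bxw x w * a * T + bww x w * T ^ 2 + 2 * bw x w * (a ^ 2 + b) ≤ 0 := by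
  have hS := sq_pos hx hw
  have hD := den_pos hx hw
  have hS2 := sq_sq hx hw
  obtain ⟨hr, hrw⟩ := root_spec hx hw
  have hE := Real.exp_pos (root x w)
  have hd : den x w = sq x w ^ 2 + root x w * Real.exp (root x w) := by
    rw [hS2, den]; ring
  rw [← hS2] at hrw
  have hx2 : Real.exp (root x w) = sq x w ^ 2 + x ^ 2 := by rw [hS2]; ring
  have key : bxx x w * a ^ 2 + 2 * bxw x w * a * T + bww x w * T ^ 2 + 2 * bw x w * (a ^ 2 + b)
      = -(root x w * x ^ 2 * a ^ 2 + a * T * x - Real.exp (root x w) * T ^ 2 / (4 * sq x w ^ 2)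
        + den x w * b) / (sq x w * den x w) := by
    unfold bxx bxw bww bw
    field_simp
    rw [hd, hx2]
    ring
  rw [key]
  refine div_nonpos_of_nonpos_of_nonneg (neg_nonpos.2 ?_) (by positivity)
  generalize Real.exp (root x w) = e at *
  generalize root x w = r at *
  generalize sq x w = S at *
  rcases hr.eq_or_lt with hr0 | hr0
  · subst hr0
    have hw0 : w = 0 := by rw [← hrw]; ring
    subst hw0
    have hT0 : T = 0 := by nlinarith
    subst hT0
    have := mul_nonneg hD.le hb0
    simpa using this
  · have hb : T ^ 2 / (4 * r * S ^ 2) ≤ b := by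
      rw [div_le_iff₀ (by positivity)]
      rw [← hrw] at hT; linarith
    have h1 : (S ^ 2 + r * e) * (T ^ 2 / (4 * r * S ^ 2)) ≤ den x w * b := by
      rw [hd]; gcongr
    have h2 : (S ^ 2 + r * e) * (T ^ 2 / (4 * r * S ^ 2))
        = T ^ 2 / (4 * r) + e * T ^ 2 / (4 * S ^ 2) := by
      field_simp
    have h3 : r * x ^ 2 * a ^ 2 + a * T * x + T ^ 2 / (4 * r)
        = (2 * r * x * a + T) ^ 2 / (4 * r) := by
      field_simp; ring
    have h4 : 0 ≤ (2 * r * x * a + T) ^ 2 / (4 * r) := by positivity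
    linarith

lemma abs_integrand_le {x t M : ℝ} (hx : x ^ 2 < 1) (ht : 0 ≤ t) (htM : t ≤ M) :
    |integrand x t| ≤ π + (1 + M) * Real.exp M := by
  have h1 : |x| ≤ 1 := (sq_lt_one_iff_abs_lt_one x).1 hx |>.le
  have h2 : |Real.arccos (-x * Real.exp (-t / 2))| ≤ π := by
    rw [abs_of_nonneg (Real.arccos_nonneg _)]; exact Real.arccos_le_pi _
  have h3 : |1 - t| ≤ 1 + M := by rw [abs_le]; constructor <;> linarith
  have h4 : √(Real.exp t - x ^ 2) ≤ Real.exp M := by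
    rw [Real.sqrt_le_left (Real.exp_pos M).le]
    have h5 : Real.exp t ≤ Real.exp M := Real.exp_le_exp.2 htM
    have h6 : 1 ≤ Real.exp M := Real.one_le_exp (by linarith)
    nlinarith [_root_.sq_nonneg x]
  refine (abs_add_le _ _).trans ?_
  rw [abs_mul, abs_mul, abs_of_nonneg (sqrt_nonneg _)]
  have h7 : |x| * |Real.arccos (-x * Real.exp (-t / 2))| ≤ 1 * π := by gcongr
  have h8 : |1 - t| * √(Real.exp t - x ^ 2) ≤ (1 + M) * Real.exp M := by gcongr; linarith
  linarith

lemma continuous_integrand : Continuous (fun p : ℝ × ℝ => integrand p.1 p.2) := by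
  unfold integrand
  have := Real.continuous_arccos
  fun_prop

lemma abs_bellman_le {x w M : ℝ} (hx : x ^ 2 < 1) (hw : 0 ≤ w) (hwM : w ≤ M) :
    |bellman x w| ≤ π + (1 + (1 + M)) * Real.exp (1 + M) :=
  abs_integrand_le hx (root_spec hx hw).1 ((root_le hx hw).trans (by linarith))

lemma tendsto_bellman {α : Type*} {l : Filter α} {U W : α → ℝ} {x w : ℝ} (hx : x ^ 2 < 1)
    (hw : 0 ≤ w) (hU : Tendsto U l (𝓝 x)) (hW : Tendsto W l (𝓝 w)) (hW0 : ∀ᶠ y in l, 0 ≤ W y) :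
    Tendsto (fun y => bellman (U y) (W y)) l (𝓝 (bellman x w)) :=
  (continuous_integrand.tendsto (x, root x w)).comp
    (hU.prodMk_nhds (tendsto_root hx hw hU hW hW0))

lemma abs_bx_le (x w : ℝ) : |bx x w| ≤ π := by
  rw [bx, abs_of_nonneg (Real.arccos_nonneg _)]
  exact Real.arccos_le_pi _

lemma exists_bound_derivs {c : ℝ} (hc : c < 1) (M : ℝ) :
    ∃ C, ∀ x w, |x| ≤ c → 0 ≤ w → w ≤ M →
      |bw x w| ≤ C ∧ |bxx x w| ≤ C ∧ |bxw x w| ≤ C ∧ |bww x w| ≤ C := by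
  set K : Set (ℝ × ℝ) := Set.Icc (-c) c ×ˢ Set.Icc 0 M with hK
  have hKc : IsCompact K := isCompact_Icc.prod isCompact_Icc
  have hx : ∀ p ∈ K, p.1 ^ 2 < 1 := by
    intro p hp
    rw [sq_lt_one_iff_abs_lt_one]
    exact (abs_le.2 hp.1).trans_lt hc
  have hroot : ContinuousOn (fun p : ℝ × ℝ => root p.1 p.2) K := by
    intro p hp
    exact tendsto_root (hx p hp) hp.2.1 continuous_fst.continuousWithinAt
      continuous_snd.continuousWithinAt
      (eventually_nhdsWithin_of_forall fun q hq => hq.2.1)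
  have hsq : ContinuousOn (fun p : ℝ × ℝ => sq p.1 p.2) K := by
    unfold sq; fun_prop
  have hden : ContinuousOn (fun p : ℝ × ℝ => den p.1 p.2) K := by
    unfold den; fun_prop
  have hsq0 : ∀ p ∈ K, sq p.1 p.2 ≠ 0 := fun p hp => (sq_pos (hx p hp) hp.2.1).ne'
  have hden0 : ∀ p ∈ K, den p.1 p.2 ≠ 0 := fun p hp => (den_pos (hx p hp) hp.2.1).ne'
  have h1 : ContinuousOn (fun p : ℝ × ℝ => bw p.1 p.2) K :=
    continuousOn_const.div (continuousOn_const.mul hsq) fun p hp => by simpa using hsq0 p hp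
  have h2 : ContinuousOn (fun p : ℝ × ℝ => bxx p.1 p.2) K :=
    (hsq.mul (continuousOn_const.add hroot)).div hden hden0
  have h3 : ContinuousOn (fun p : ℝ × ℝ => bxw p.1 p.2) K :=
    continuous_fst.neg.continuousOn.div ((continuousOn_const.mul hsq).mul hden)
      fun p hp => by simpa using ⟨hsq0 p hp, hden0 p hp⟩
  have h4 : ContinuousOn (fun p : ℝ × ℝ => bww p.1 p.2) K :=
    hroot.rexp.div ((continuousOn_const.mul (hsq.pow 3)).mul hden)
      fun p hp => by simpa using ⟨hsq0 p hp, hden0 p hp⟩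
  obtain ⟨C1, hC1⟩ := hKc.exists_bound_of_continuousOn h1
  obtain ⟨C2, hC2⟩ := hKc.exists_bound_of_continuousOn h2
  obtain ⟨C3, hC3⟩ := hKc.exists_bound_of_continuousOn h3
  obtain ⟨C4, hC4⟩ := hKc.exists_bound_of_continuousOn h4
  refine ⟨max (max C1 C2) (max C3 C4), fun x w hxc hw hwM => ?_⟩
  have hp : (x, w) ∈ K := ⟨abs_le.1 hxc, hw, hwM⟩
  exact ⟨(hC1 _ hp).trans (by simp), (hC2 _ hp).trans (by simp), (hC3 _ hp).trans (by simp),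
    (hC4 _ hp).trans (by simp)⟩

/-- Bounded real functions. -/
def Bdd {α : Type*} (h : α → ℝ) : Prop := ∃ C, ∀ z, |h z| ≤ C

namespace Bdd

variable {α : Type*} {g h : α → ℝ}

lemma add (hg : Bdd g) (hh : Bdd h) : Bdd fun z => g z + h z := by
  obtain ⟨C, hC⟩ := hg
  obtain ⟨C', hC'⟩ := hh
  exact ⟨C + C', fun z => (abs_add_le _ _).trans (add_le_add (hC z) (hC' z))⟩

lemma mul (hg : Bdd g) (hh : Bdd h) : Bdd fun z => g z * h z := by
  obtain ⟨C, hC⟩ := hg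
  obtain ⟨C', hC'⟩ := hh
  refine ⟨C * C', fun z => ?_⟩
  rw [abs_mul]
  exact mul_le_mul (hC z) (hC' z) (abs_nonneg _) ((abs_nonneg _).trans (hC z))

lemma const (c : ℝ) : Bdd fun _ : α => c := ⟨|c|, fun _ => le_rfl⟩

lemma sum {ι : Type*} (s : Finset ι) {g : ι → α → ℝ} (hg : ∀ i, Bdd (g i)) :
    Bdd fun z => ∑ i ∈ s, g i z := by
  choose C hC using hg
  exact ⟨∑ i ∈ s, C i, fun z => (Finset.abs_sum_le_sum_abs _ _).trans
    (Finset.sum_le_sum fun i _ => hC i z)⟩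

end Bdd

lemma Nice.bdd_ou {g : Euc n → ℝ} (hg : Nice g) (s : ℝ) : Bdd (ou s g) := by
  obtain ⟨C, hC⟩ := hg.bound
  exact ⟨C, abs_ou_le hC s⟩

lemma differentiable_ou {g : Euc n → ℝ} (hg : Nice g) (s : ℝ) : Differentiable ℝ (ou s g) :=
  fun z => (hasFDerivAt_ou hg s z).differentiableAt

lemma continuous_ou_space {g : Euc n → ℝ} (hg : Nice g) (s : ℝ) : Continuous (ou s g) :=
  (differentiable_ou hg s).continuous

/-- The time derivative of `ou s g z`. -/
noncomputable def dou (s : ℝ) (g : Euc n → ℝ) (z : Euc n) : ℝ :=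
  1 / 2 * ((√s)⁻¹ * ∑ i, z i * ou s (pd i g) z - ∑ i, ou s (pd i (pd i g)) z)

/-- The squared norm of the gradient of `ou s f`. -/
noncomputable def energy (s : ℝ) (f : Euc n → ℝ) (z : Euc n) : ℝ :=
  s * ∑ j, ou s (pd j f) z ^ 2

lemma continuous_dou {g : Euc n → ℝ} (hg : Nice g) (s : ℝ) : Continuous (dou s g) := by
  have h1 := fun i => continuous_ou_space (hg.pd i) s
  have h2 := fun i => continuous_ou_space ((hg.pd i).pd i) s
  unfold dou; fun_prop

lemma exists_abs_dou_le {g : Euc n → ℝ} (hg : Nice g) {s₀ : ℝ} (hs₀ : 0 < s₀) :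
    ∃ K, 0 ≤ K ∧ ∀ s, s₀ ≤ s → ∀ z : Euc n, |dou s g z| ≤ K * (1 + ‖z‖) := by
  choose C hC using fun i => (hg.pd i).bound
  choose C' hC' using fun i => ((hg.pd i).pd i).bound
  have hC0 : ∀ i, 0 ≤ C i := fun i => (abs_nonneg _).trans (hC i 0)
  have hC0' : ∀ i, 0 ≤ C' i := fun i => (abs_nonneg _).trans (hC' i 0)
  have hs1 : 0 < √s₀ := sqrt_pos.2 hs₀
  have hA : 0 ≤ ∑ i, C i := Finset.sum_nonneg fun i _ => hC0 i
  have hA' : 0 ≤ ∑ i, C' i := Finset.sum_nonneg fun i _ => hC0' i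
  refine ⟨(√s₀)⁻¹ * (∑ i, C i) + ∑ i, C' i, by positivity, fun s hs z => ?_⟩
  have h1 : |∑ i, z i * ou s (pd i g) z| ≤ ‖z‖ * ∑ i, C i := by
    rw [Finset.mul_sum]
    refine (Finset.abs_sum_le_sum_abs _ _).trans (Finset.sum_le_sum fun i _ => ?_)
    rw [abs_mul]
    have := hC0 i
    gcongr
    · exact PiLp.norm_apply_le z i
    · exact abs_ou_le (hC i) s z
  have h2 : |∑ i, ou s (pd i (pd i g)) z| ≤ ∑ i, C' i :=
    (Finset.abs_sum_le_sum_abs _ _).trans (Finset.sum_le_sum fun i _ => abs_ou_le (hC' i) s z)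
  have h3 : (√s)⁻¹ ≤ (√s₀)⁻¹ := by
    gcongr
  have h4 : |(√s)⁻¹ * ∑ i, z i * ou s (pd i g) z| ≤ (√s₀)⁻¹ * (‖z‖ * ∑ i, C i) := by
    rw [abs_mul, abs_of_nonneg (by positivity)]
    gcongr
  have h5 := abs_sub ((√s)⁻¹ * ∑ i, z i * ou s (pd i g) z) (∑ i, ou s (pd i (pd i g)) z)
  have h6 : 0 ≤ (√s₀)⁻¹ * (∑ i, C i) := by positivity
  have h7 := norm_nonneg z
  unfold dou
  rw [abs_mul, abs_of_nonneg (by norm_num : (0 : ℝ) ≤ 1 / 2)]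
  nlinarith [mul_nonneg hA' h7, mul_nonneg h6 h7]

lemma energy_nonneg {s : ℝ} (hs : 0 ≤ s) (f : Euc n → ℝ) (z : Euc n) : 0 ≤ energy s f z :=
  mul_nonneg hs (Finset.sum_nonneg fun _ _ => _root_.sq_nonneg _)

lemma exists_energy_le {f : Euc n → ℝ} (hf : Nice f) :
    ∃ M, ∀ s ∈ Set.Icc (0 : ℝ) 1, ∀ z, energy s f z ≤ M := by
  choose C hC using fun i => (hf.pd i).bound
  refine ⟨∑ i, C i ^ 2, fun s hs z => ?_⟩
  have h1 : ∑ j, ou s (pd j f) z ^ 2 ≤ ∑ i, C i ^ 2 :=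
    Finset.sum_le_sum fun i _ => sq_le_sq' (by linarith [abs_le.1 (abs_ou_le (hC i) s z)])
      (abs_le.1 (abs_ou_le (hC i) s z)).2
  have h2 : 0 ≤ ∑ j, ou s (pd j f) z ^ 2 := Finset.sum_nonneg fun _ _ => _root_.sq_nonneg _
  unfold energy
  nlinarith [hs.1, hs.2]

lemma continuous_energy {f : Euc n → ℝ} (hf : Nice f) :
    Continuous (fun p : ℝ × Euc n => energy p.1 f p.2) := by
  have := fun j => continuous_ou (hf.pd j)
  unfold energy; fun_prop

lemma hasFDerivAt_energy {f : Euc n → ℝ} (hf : Nice f) (s : ℝ) (z : Euc n) :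
    HasFDerivAt (energy s f)
      (s • ∑ j, (2 * ou s (pd j f) z) • fderiv ℝ (ou s (pd j f)) z) z := by
  have h := (HasFDerivAt.fun_sum (u := Finset.univ) fun (j : Fin n) _ =>
    ((differentiable_ou (hf.pd j) s z).hasFDerivAt.pow 2)).const_mul s
  refine h.congr_fderiv ?_
  simp

lemma hasDerivAt_energy {f : Euc n → ℝ} (hf : Nice f) {s : ℝ} (hs : s ∈ Set.Ioo (0 : ℝ) 1)
    (z : Euc n) :
    HasDerivAt (fun s => energy s f z)
      (∑ j, ou s (pd j f) z ^ 2 + s * ∑ j, 2 * ou s (pd j f) z * dou s (pd j f) z) s := by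
  have h := (hasDerivAt_id s).mul (HasDerivAt.fun_sum (u := Finset.univ) fun (j : Fin n) _ =>
    ((hasDerivAt_ou (hf.pd j) hs z).pow 2))
  refine h.congr_deriv ?_
  simp [dou]

/-- The time derivative of `bellman (ou s f z) (energy s f z)`. -/
noncomputable def dflow (s : ℝ) (f : Euc n → ℝ) (z : Euc n) : ℝ :=
  bx (ou s f z) (energy s f z) * dou s f z + bw (ou s f z) (energy s f z) *
    (∑ j, ou s (pd j f) z ^ 2 + s * ∑ j, 2 * ou s (pd j f) z * dou s (pd j f) z)

section Flow

variable {f : Euc n → ℝ} (hf : Nice f) {c : ℝ} (hc : c < 1) (hfc : ∀ x, |f x| ≤ c)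
include hf hc hfc

omit hf in
lemma ou_sq_lt_one (s : ℝ) (z : Euc n) : ou s f z ^ 2 < 1 := by
  rw [sq_lt_one_iff_abs_lt_one]
  exact (abs_ou_le hfc s z).trans_lt hc

lemma hasDerivAt_flow {s : ℝ} (hs : s ∈ Set.Ioo (0 : ℝ) 1) (z : Euc n) :
    HasDerivAt (fun s => bellman (ou s f z) (energy s f z)) (dflow s f z) s := by
  have h := (hasFDerivAt_bellman (hasDerivAt_ou hf hs z).hasFDerivAt
    (hasDerivAt_energy hf hs z).hasFDerivAt (ou_sq_lt_one hc hfc s z) (by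
      filter_upwards [lt_mem_nhds hs.1] with t ht using energy_nonneg ht.le f z)).hasDerivAt
  refine h.congr_deriv ?_
  simp [dflow, dou]

lemma hasFDerivAt_bx_flow {s : ℝ} (hs : 0 ≤ s) (z : Euc n) :
    HasFDerivAt (fun z => bx (ou s f z) (energy s f z))
      (bxx (ou s f z) (energy s f z) • fderiv ℝ (ou s f) z
        + bxw (ou s f z) (energy s f z) •
          (s • ∑ j, (2 * ou s (pd j f) z) • fderiv ℝ (ou s (pd j f)) z)) z :=
  hasFDerivAt_bx (differentiable_ou hf s z).hasFDerivAt (hasFDerivAt_energy hf s z)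
    (ou_sq_lt_one hc hfc s z) (Eventually.of_forall fun z => energy_nonneg hs f z)

lemma hasFDerivAt_bw_flow {s : ℝ} (hs : 0 ≤ s) (z : Euc n) :
    HasFDerivAt (fun z => bw (ou s f z) (energy s f z))
      (bxw (ou s f z) (energy s f z) • fderiv ℝ (ou s f) z
        + bww (ou s f z) (energy s f z) •
          (s • ∑ j, (2 * ou s (pd j f) z) • fderiv ℝ (ou s (pd j f)) z)) z :=
  hasFDerivAt_bw (differentiable_ou hf s z).hasFDerivAt (hasFDerivAt_energy hf s z)
    (ou_sq_lt_one hc hfc s z) (Eventually.of_forall fun z => energy_nonneg hs f z)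

lemma continuous_dflow {s : ℝ} (hs : 0 ≤ s) : Continuous (dflow s f) := by
  have h1 : Continuous fun z => bx (ou s f z) (energy s f z) :=
    continuous_iff_continuousAt.2 fun z => (hasFDerivAt_bx_flow hf hc hfc hs z).continuousAt
  have h2 : Continuous fun z => bw (ou s f z) (energy s f z) :=
    continuous_iff_continuousAt.2 fun z => (hasFDerivAt_bw_flow hf hc hfc hs z).continuousAt
  have h3 := continuous_dou hf s
  have h4 := fun j => continuous_dou (hf.pd j) s
  have h5 := fun j => continuous_ou_space (hf.pd j) s
  exact (h1.mul h3).add (h2.mul ((continuous_finsetSum _ fun j _ => (h5 j).pow 2).add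
    (continuous_const.mul (continuous_finsetSum _ fun j _ =>
      (continuous_const.mul (h5 j)).mul (h4 j)))))

lemma bdd_derivs {s : ℝ} (hs : s ∈ Set.Icc (0 : ℝ) 1) :
    Bdd (fun z => bx (ou s f z) (energy s f z)) ∧ Bdd (fun z => bw (ou s f z) (energy s f z)) ∧
    Bdd (fun z => bxx (ou s f z) (energy s f z)) ∧ Bdd (fun z => bxw (ou s f z) (energy s f z)) ∧
    Bdd (fun z => bww (ou s f z) (energy s f z)) := by
  obtain ⟨M, hM⟩ := exists_energy_le hf
  obtain ⟨C, hC⟩ := exists_bound_derivs hc M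
  have h := fun z => hC _ _ (abs_ou_le hfc s z) (energy_nonneg hs.1 f z) (hM s hs z)
  refine ⟨⟨π, fun z => ?_⟩, ⟨C, fun z => (h z).1⟩, ⟨C, fun z => (h z).2.1⟩,
    ⟨C, fun z => (h z).2.2.1⟩, ⟨C, fun z => (h z).2.2.2⟩⟩
  exact abs_bx_le _ _

lemma exists_abs_dflow_le {s₀ : ℝ} (hs₀ : 0 < s₀) :
    ∃ K, ∀ s ∈ Set.Icc s₀ 1, ∀ z : Euc n, |dflow s f z| ≤ K * (1 + ‖z‖) := by
  obtain ⟨M, hM⟩ := exists_energy_le hf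
  obtain ⟨C, hC⟩ := exists_bound_derivs hc M
  obtain ⟨K, hK0, hK⟩ := exists_abs_dou_le hf hs₀
  choose A hA using fun j => (hf.pd j).bound
  choose B hB0 hB using fun j => exists_abs_dou_le (hf.pd j) hs₀
  have hA0 : ∀ j, 0 ≤ A j := fun j => (abs_nonneg _).trans (hA j 0)
  refine ⟨π * K + C * (∑ j, A j ^ 2 + ∑ j, 2 * A j * B j), fun s hs z => ?_⟩
  have hs' : s ∈ Set.Icc (0 : ℝ) 1 := ⟨hs₀.le.trans hs.1, hs.2⟩
  have h1 := (hC _ _ (abs_ou_le hfc s z) (energy_nonneg hs'.1 f z) (hM s hs' z)).1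
  have hC0 : 0 ≤ C := (abs_nonneg _).trans h1
  have hz := norm_nonneg z
  have h2 : |∑ j, ou s (pd j f) z ^ 2| ≤ (∑ j, A j ^ 2) * (1 + ‖z‖) := by
    rw [abs_of_nonneg (Finset.sum_nonneg fun _ _ => _root_.sq_nonneg _)]
    have : ∑ j, ou s (pd j f) z ^ 2 ≤ ∑ j, A j ^ 2 := by
      refine Finset.sum_le_sum fun j _ => ?_
      rw [← sq_abs]
      gcongr
      exact abs_ou_le (hA j) s z
    have h0 : 0 ≤ ∑ j, A j ^ 2 := Finset.sum_nonneg fun _ _ => _root_.sq_nonneg _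
    nlinarith [mul_nonneg h0 hz]
  have h3 : |s * ∑ j, 2 * ou s (pd j f) z * dou s (pd j f) z|
      ≤ (∑ j, 2 * A j * B j) * (1 + ‖z‖) := by
    have h4 : |∑ j, 2 * ou s (pd j f) z * dou s (pd j f) z|
        ≤ (∑ j, 2 * A j * B j) * (1 + ‖z‖) := by
      rw [Finset.sum_mul]
      refine (Finset.abs_sum_le_sum_abs _ _).trans (Finset.sum_le_sum fun j _ => ?_)
      rw [abs_mul, abs_mul, abs_two, mul_assoc _ (B j)]
      have := hA0 j
      gcongr
      · exact abs_ou_le (hA j) s z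
      · exact hB j s hs.1 z
    rw [abs_mul, abs_of_nonneg hs'.1]
    exact (mul_le_of_le_one_left (abs_nonneg _) hs.2).trans h4
  have h5 : |bx (ou s f z) (energy s f z)| ≤ π := abs_bx_le _ _
  have h6 := hK s hs.1 z
  refine (abs_add_le _ _).trans ?_
  rw [abs_mul, abs_mul]
  calc _ ≤ π * (K * (1 + ‖z‖)) + C * ((∑ j, A j ^ 2) * (1 + ‖z‖)
        + (∑ j, 2 * A j * B j) * (1 + ‖z‖)) := by
        have h7 := (abs_add_le _ _).trans (add_le_add h2 h3)
        gcongr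
    _ = _ := by ring

lemma continuous_bellman_space {s : ℝ} (hs : 0 ≤ s) :
    Continuous fun z => bellman (ou s f z) (energy s f z) := by
  refine continuous_iff_continuousAt.2 fun z => ?_
  have h := hasFDerivAt_bellman (differentiable_ou hf s z).hasFDerivAt (hasFDerivAt_energy hf s z)
    (ou_sq_lt_one hc hfc s z) (Eventually.of_forall fun z => energy_nonneg hs f z)
  exact h.continuousAt

lemma hasDerivAt_integral_flow {s : ℝ} (hs : s ∈ Set.Ioo (0 : ℝ) 1) :
    HasDerivAt (fun s => ∫ z, bellman (ou s f z) (energy s f z) ∂(gauss n))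
      (∫ z, dflow s f z ∂(gauss n)) s := by
  obtain ⟨M, hM⟩ := exists_energy_le hf
  have hs0 := hs.1
  obtain ⟨K, hK⟩ := exists_abs_dflow_le hf hc hfc (half_pos hs.1)
  refine (hasDerivAt_integral_of_dominated_loc_of_deriv_le (𝕜 := ℝ) (E := ℝ) (μ := gauss n)
    (F := fun s z => bellman (ou s f z) (energy s f z)) (F' := fun s z => dflow s f z)
    (s := Set.Ioo (s / 2) 1) (bound := fun z => K * (1 + ‖z‖))
    (Ioo_mem_nhds (by linarith) hs.2) ?_ ?_ ?_ ?_ ?_ ?_).2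
  · filter_upwards [lt_mem_nhds hs.1] with t ht
    exact (continuous_bellman_space hf hc hfc ht.le).aestronglyMeasurable
  · exact integrable_of_bound (continuous_bellman_space hf hc hfc hs.1.le).aestronglyMeasurable
      fun z => abs_bellman_le (ou_sq_lt_one hc hfc s z) (energy_nonneg hs.1.le f z)
        (hM s ⟨hs.1.le, hs.2.le⟩ z)
  · exact (continuous_dflow hf hc hfc hs.1.le).aestronglyMeasurable
  · exact Eventually.of_forall fun z t ht => hK t ⟨ht.1.le, ht.2.le⟩ z
  · exact ((integrable_const 1).add integrable_norm_gauss).const_mul K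
  · exact Eventually.of_forall fun z t ht =>
      hasDerivAt_flow hf hc hfc ⟨(half_pos hs.1).trans ht.1, ht.2⟩ z

lemma continuousOn_integral_flow :
    ContinuousOn (fun s => ∫ z, bellman (ou s f z) (energy s f z) ∂(gauss n))
      (Set.Icc 0 1) := by
  obtain ⟨M, hM⟩ := exists_energy_le hf
  refine continuousOn_of_dominated
    (bound := fun _ => π + (1 + (1 + M)) * Real.exp (1 + M)) ?_ ?_ (integrable_const _) ?_
  · exact fun s hs => (continuous_bellman_space hf hc hfc hs.1).aestronglyMeasurable
  · exact fun s hs => Eventually.of_forall fun z =>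
      abs_bellman_le (ou_sq_lt_one hc hfc s z) (energy_nonneg hs.1 f z) (hM s hs z)
  · refine Eventually.of_forall fun z s hs => ?_
    have h1 : Continuous fun s => ou s f z := (continuous_ou hf).comp (by fun_prop : Continuous
      fun s : ℝ => (s, z))
    have h2 : Continuous fun s => energy s f z := (continuous_energy hf).comp (by fun_prop :
      Continuous fun s : ℝ => (s, z))
    exact tendsto_bellman (ou_sq_lt_one hc hfc s z) (energy_nonneg hs.1 f z)
      h1.continuousWithinAt h2.continuousWithinAt
      (eventually_nhdsWithin_of_forall fun t ht => energy_nonneg ht.1 f z)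

end Flow

/-- The derivative of `energy s f` in the `i`-th direction, divided by `√s`. -/
noncomputable def cross (s : ℝ) (f : Euc n → ℝ) (i : Fin n) (z : Euc n) : ℝ :=
  2 * s * ∑ j, ou s (pd j f) z * ou s (pd i (pd j f)) z

lemma hasFDerivAt_cross {f : Euc n → ℝ} (hf : Nice f) (s : ℝ) (i : Fin n) (z : Euc n) :
    HasFDerivAt (cross s f i)
      ((2 * s) • ∑ j, (ou s (pd j f) z • fderiv ℝ (ou s (pd i (pd j f))) z
        + ou s (pd i (pd j f)) z • fderiv ℝ (ou s (pd j f)) z)) z :=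
  (HasFDerivAt.fun_sum (u := Finset.univ) fun (j : Fin n) _ =>
    ((differentiable_ou (hf.pd j) s z).hasFDerivAt.mul
      (differentiable_ou ((hf.pd j).pd i) s z).hasFDerivAt)).const_mul (2 * s)

lemma cross_sq_le (s : ℝ) (f : Euc n → ℝ) (i : Fin n) (z : Euc n) :
    cross s f i z ^ 2 ≤ 4 * energy s f z * (s * ∑ j, ou s (pd i (pd j f)) z ^ 2) := by
  have h := Finset.sum_mul_sq_le_sq_mul_sq Finset.univ (fun j => ou s (pd j f) z)
    fun j => ou s (pd i (pd j f)) z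
  unfold cross energy
  calc _ = 4 * s ^ 2 * (∑ j, ou s (pd j f) z * ou s (pd i (pd j f)) z) ^ 2 := by ring
    _ ≤ 4 * s ^ 2 * ((∑ j, ou s (pd j f) z ^ 2) * ∑ j, ou s (pd i (pd j f)) z ^ 2) := by gcongr
    _ = _ := by ring

/-- The vector field whose divergence is compared with `dflow`. -/
noncomputable def field (s : ℝ) (f : Euc n → ℝ) (i : Fin n) (z : Euc n) : ℝ :=
  bx (ou s f z) (energy s f z) * ou s (pd i f) z + bw (ou s f z) (energy s f z) * cross s f i z

/-- The part of `dflow` without explicit dependence on the coordinates. -/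
noncomputable def rest (s : ℝ) (f : Euc n → ℝ) (i : Fin n) (z : Euc n) : ℝ :=
  2 * bw (ou s f z) (energy s f z) * ou s (pd i f) z ^ 2
    - bx (ou s f z) (energy s f z) * ou s (pd i (pd i f)) z
    - 2 * s * bw (ou s f z) (energy s f z) *
      ∑ j, ou s (pd j f) z * ou s (pd i (pd i (pd j f))) z

lemma dflow_eq (s : ℝ) (f : Euc n → ℝ) (z : Euc n) :
    dflow s f z = 1 / 2 * ∑ i, ((√s)⁻¹ * (z i * field s f i z) + rest s f i z) := by
  have h : ∑ j, 2 * ou s (pd j f) z * dou s (pd j f) z =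
      ∑ i, ((√s)⁻¹ * (z i * ∑ j, ou s (pd j f) z * ou s (pd i (pd j f)) z)
        - ∑ j, ou s (pd j f) z * ou s (pd i (pd i (pd j f))) z) := by
    simp only [dou, Finset.mul_sum, Finset.sum_sub_distrib, mul_sub]
    congr 1
    · rw [Finset.sum_comm]
      exact Finset.sum_congr rfl fun i _ => Finset.sum_congr rfl fun j _ => by ring
    · rw [Finset.sum_comm]
      exact Finset.sum_congr rfl fun i _ => Finset.sum_congr rfl fun j _ => by ring
  have key : ∀ (y u v A B : Fin n → ℝ) (p q k : ℝ),
      p * (1 / 2 * (k * ∑ i, y i * u i - ∑ i, v i))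
        + q * (∑ i, u i ^ 2 + s * ∑ i, (k * (y i * A i) - B i)) =
      1 / 2 * ∑ i, (k * (y i * (p * u i + q * (2 * s * A i)))
        + (2 * q * u i ^ 2 - p * v i - 2 * s * q * B i)) := by
    intro y u v A B p q k
    simp only [Finset.mul_sum, ← Finset.sum_sub_distrib, ← Finset.sum_add_distrib]
    exact Finset.sum_congr rfl fun i _ => by ring
  rw [dflow, h]
  exact key _ _ _ _ _ _ _ _

section Flow

variable {f : Euc n → ℝ} (hf : Nice f) {c : ℝ} (hc : c < 1) (hfc : ∀ x, |f x| ≤ c)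
include hf hc hfc

lemma differentiable_field {s : ℝ} (hs : 0 ≤ s) (i : Fin n) : Differentiable ℝ (field s f i) :=
  fun z => (((hasFDerivAt_bx_flow hf hc hfc hs z).mul
    (differentiable_ou (hf.pd i) s z).hasFDerivAt).add
      ((hasFDerivAt_bw_flow hf hc hfc hs z).mul (hasFDerivAt_cross hf s i z))).differentiableAt

lemma fderiv_field {s : ℝ} (hs : 0 ≤ s) (i : Fin n) (z : Euc n) :
    fderiv ℝ (field s f i) z (EuclideanSpace.single i 1) =
      √s * (bxx (ou s f z) (energy s f z) * ou s (pd i f) z ^ 2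
        + 2 * bxw (ou s f z) (energy s f z) * ou s (pd i f) z * cross s f i z
        + bww (ou s f z) (energy s f z) * cross s f i z ^ 2
        + bx (ou s f z) (energy s f z) * ou s (pd i (pd i f)) z
        + 2 * s * bw (ou s f z) (energy s f z) * (∑ j, ou s (pd i (pd j f)) z ^ 2
          + ∑ j, ou s (pd j f) z * ou s (pd i (pd i (pd j f))) z)) := by
  have h := ((hasFDerivAt_bx_flow hf hc hfc hs z).mul
    (differentiable_ou (hf.pd i) s z).hasFDerivAt).add
      ((hasFDerivAt_bw_flow hf hc hfc hs z).mul (hasFDerivAt_cross hf s i z))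
  have h' : HasFDerivAt (field s f i) _ z := h
  have h1 : s * ∑ j, 2 * ou s (pd j f) z * (√s * ou s (pd i (pd j f)) z)
      = √s * cross s f i z := by
    simp only [cross, Finset.mul_sum]
    exact Finset.sum_congr rfl fun j _ => by ring
  have h2 : ∑ j, (ou s (pd j f) z * (√s * ou s (pd i (pd i (pd j f))) z)
      + ou s (pd i (pd j f)) z * (√s * ou s (pd i (pd j f)) z)) =
      √s * (∑ j, ou s (pd i (pd j f)) z ^ 2
          + ∑ j, ou s (pd j f) z * ou s (pd i (pd i (pd j f))) z) := by
    rw [← Finset.sum_add_distrib, Finset.mul_sum]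
    exact Finset.sum_congr rfl fun j _ => by ring
  rw [h'.fderiv]
  simp only [add_apply, smul_apply, smul_eq_mul,
    sum_apply, fderiv_ou_single hf, fderiv_ou_single (hf.pd _),
    fderiv_ou_single ((hf.pd _).pd _), h1, h2]
  ring

lemma fderiv_field_add_rest_nonpos {s : ℝ} (hs : 0 < s) (i : Fin n) (z : Euc n) :
    (√s)⁻¹ * fderiv ℝ (field s f i) z (EuclideanSpace.single i 1) + rest s f i z ≤ 0 := by
  have h := quad_nonpos (ou_sq_lt_one hc hfc s z) (energy_nonneg hs.le f z) (a := ou s (pd i f) z)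
    (mul_nonneg hs.le (Finset.sum_nonneg fun j _ => _root_.sq_nonneg (ou s (pd i (pd j f)) z)))
    (cross_sq_le s f i z)
  rw [fderiv_field hf hc hfc hs.le, inv_mul_cancel_left₀ (sqrt_pos.2 hs).ne']
  refine le_of_eq_of_le ?_ h
  unfold rest
  ring

omit hc hfc in
lemma bdd_cross (s : ℝ) (i : Fin n) : Bdd (cross s f i) :=
  (Bdd.const _).mul (Bdd.sum _ fun j => ((hf.pd j).bdd_ou s).mul (((hf.pd j).pd i).bdd_ou s))

lemma bdd_field {s : ℝ} (hs : s ∈ Set.Icc (0 : ℝ) 1) (i : Fin n) : Bdd (field s f i) := by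
  obtain ⟨h1, h2, -⟩ := bdd_derivs hf hc hfc hs
  exact (h1.mul ((hf.pd i).bdd_ou s)).add (h2.mul (bdd_cross hf s i))

lemma bdd_fderiv_field {s : ℝ} (hs : s ∈ Set.Icc (0 : ℝ) 1) (i : Fin n) :
    Bdd fun z => fderiv ℝ (field s f i) z (EuclideanSpace.single i 1) := by
  obtain ⟨h1, h2, h3, h4, h5⟩ := bdd_derivs hf hc hfc hs
  have hu := fun j => (hf.pd j).bdd_ou s
  have hv := fun j => ((hf.pd j).pd i).bdd_ou s
  have hw := fun j => (((hf.pd j).pd i).pd i).bdd_ou s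
  have hT := bdd_cross hf s i
  simp only [fderiv_field hf hc hfc hs.1, pow_two]
  exact (Bdd.const _).mul (((((h3.mul ((hu i).mul (hu i))).add
    ((((Bdd.const 2).mul h4).mul (hu i)).mul hT)).add (h5.mul (hT.mul hT))).add
    (h1.mul (hv i))).add (((Bdd.const _).mul h2).mul
      ((Bdd.sum _ fun j => (hv j).mul (hv j)).add (Bdd.sum _ fun j => (hu j).mul (hw j)))))

lemma bdd_rest {s : ℝ} (hs : s ∈ Set.Icc (0 : ℝ) 1) (i : Fin n) : Bdd (rest s f i) := by
  obtain ⟨h1, h2, -⟩ := bdd_derivs hf hc hfc hs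
  have hu := fun j => (hf.pd j).bdd_ou s
  have hv := fun j => ((hf.pd j).pd i).bdd_ou s
  have hw := fun j => (((hf.pd j).pd i).pd i).bdd_ou s
  have h : Bdd fun z => 2 * bw (ou s f z) (energy s f z) * (ou s (pd i f) z * ou s (pd i f) z)
    + -1 * (bx (ou s f z) (energy s f z) * ou s (pd i (pd i f)) z)
    + -1 * (2 * s * bw (ou s f z) (energy s f z) *
      ∑ j, ou s (pd j f) z * ou s (pd i (pd i (pd j f))) z) :=
    ((((Bdd.const 2).mul h2).mul ((hu i).mul (hu i))).add ((Bdd.const _).mul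
      (h1.mul (hv i)))).add ((Bdd.const _).mul (((Bdd.const _).mul h2).mul
        (Bdd.sum _ fun j => (hu j).mul (hw j))))
  convert h using 2 with z
  unfold rest
  ring

lemma continuous_rest {s : ℝ} (hs : 0 ≤ s) (i : Fin n) : Continuous (rest s f i) := by
  have h1 : Continuous fun z => bx (ou s f z) (energy s f z) :=
    continuous_iff_continuousAt.2 fun z => (hasFDerivAt_bx_flow hf hc hfc hs z).continuousAt
  have h2 : Continuous fun z => bw (ou s f z) (energy s f z) :=
    continuous_iff_continuousAt.2 fun z => (hasFDerivAt_bw_flow hf hc hfc hs z).continuousAt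
  have hu := fun j => continuous_ou_space (hf.pd j) s
  have hv := fun j => continuous_ou_space ((hf.pd j).pd i) s
  have hw := fun j => continuous_ou_space (((hf.pd j).pd i).pd i) s
  exact (((continuous_const.mul h2).mul ((hu i).pow 2)).sub (h1.mul (hv i))).sub
    ((continuous_const.mul h2).mul (continuous_finsetSum _ fun j _ => (hu j).mul (hw j)))

lemma integral_dflow_nonpos {s : ℝ} (hs : s ∈ Set.Ioo (0 : ℝ) 1) :
    ∫ z, dflow s f z ∂(gauss n) ≤ 0 := by
  have hs' : s ∈ Set.Icc (0 : ℝ) 1 := ⟨hs.1.le, hs.2.le⟩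
  have hY : ∀ i, Integrable (fun z : Euc n => z i * field s f i z) (gauss n) := by
    intro i
    obtain ⟨C, hC⟩ := bdd_field hf hc hfc hs' i
    have hcont := (differentiable_field hf hc hfc hs.1.le i).continuous
    refine integrable_of_bound_mul (A := 0) (C := C) (by fun_prop) fun z => ?_
    rw [abs_mul, zero_add, mul_comm]
    exact mul_le_mul (hC z) (PiLp.norm_apply_le z i) (abs_nonneg _) ((abs_nonneg _).trans (hC z))
  have hR : ∀ i, Integrable (rest s f i) (gauss n) := fun i => by
    obtain ⟨C, hC⟩ := bdd_rest hf hc hfc hs' i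
    exact integrable_of_bound (continuous_rest hf hc hfc hs.1.le i).aestronglyMeasurable hC
  have hD : ∀ i, Integrable (fun z => fderiv ℝ (field s f i) z (EuclideanSpace.single i 1))
      (gauss n) := fun i => by
    obtain ⟨C, hC⟩ := bdd_fderiv_field hf hc hfc hs' i
    exact integrable_of_bound
      (measurable_fderiv_apply_const ℝ (field s f i) _).aestronglyMeasurable hC
  have hP : ∀ i, ∫ z, z i * field s f i z ∂(gauss n)
      = ∫ z, fderiv ℝ (field s f i) z (EuclideanSpace.single i 1) ∂(gauss n) := fun i => by
    obtain ⟨C, hC⟩ := bdd_field hf hc hfc hs' i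
    obtain ⟨C', hC'⟩ := bdd_fderiv_field hf hc hfc hs' i
    rw [← integral_mul_coord (differentiable_field hf hc hfc hs.1.le i) hC _ hC']
    simp [EuclideanSpace.inner_single_right]
  have hS : ∀ i, Integrable (fun z : Euc n => (√s)⁻¹ * (z i * field s f i z) + rest s f i z)
      (gauss n) := fun i => ((hY i).const_mul _).add (hR i)
  simp only [dflow_eq]
  rw [integral_const_mul, integral_finsetSum _ fun i _ => hS i]
  refine mul_nonpos_of_nonneg_of_nonpos (by norm_num) (Finset.sum_nonpos fun i _ => ?_)
  rw [integral_add ((hY i).const_mul _) (hR i), integral_const_mul, hP, ← integral_const_mul,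
    ← integral_add ((hD i).const_mul _) (hR i)]
  exact integral_nonpos fun z => fderiv_field_add_rest_nonpos hf hc hfc hs.1 i z

lemma integral_bellman_le_of_abs_le :
    ∫ x, bellman (f x) (‖fderiv ℝ f x‖ ^ 2) ∂(gauss n) ≤ bellman (∫ x, f x ∂(gauss n)) 0 := by
  have h : AntitoneOn (fun s => ∫ z, bellman (ou s f z) (energy s f z) ∂(gauss n))
      (Set.Icc 0 1) := by
    refine antitoneOn_of_deriv_nonpos (convex_Icc 0 1) (continuousOn_integral_flow hf hc hfc) ?_ ?_
      <;> rw [interior_Icc] <;> intro s hs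
    · exact (hasDerivAt_integral_flow hf hc hfc hs).differentiableAt.differentiableWithinAt
    · rw [(hasDerivAt_integral_flow hf hc hfc hs).deriv]
      exact integral_dflow_nonpos hf hc hfc hs
  have h1 := h (Set.left_mem_Icc.2 zero_le_one) (Set.right_mem_Icc.2 zero_le_one) zero_le_one
  simpa [energy, ou_zero, ou_one, norm_fderiv_sq] using h1

end Flow

lemma bellman_zero {x : ℝ} (hx : x ^ 2 < 1) :
    bellman x 0 = x * Real.arccos (-x) + √(1 - x ^ 2) := by
  simp [bellman, integrand, root_zero hx]

lemma integral_bellman_le {f : Euc n → ℝ} (hf : Nice f) (hf1 : ∀ x, f x ^ 2 < 1) :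
    ∫ x, bellman (f x) (‖fderiv ℝ f x‖ ^ 2) ∂(gauss n) ≤
      (∫ x, f x ∂(gauss n)) * Real.arccos (-∫ x, f x ∂(gauss n))
        + √(1 - (∫ x, f x ∂(gauss n)) ^ 2) := by
  obtain ⟨K, hK⟩ := hf.bound_fderiv
  have hK0 : 0 ≤ K := (norm_nonneg _).trans (hK 0)
  have habs : ∀ x, |f x| ≤ 1 := fun x => ((sq_lt_one_iff_abs_lt_one _).1 (hf1 x)).le
  have hm : |∫ x, f x ∂(gauss n)| ≤ 1 := by
    simpa using norm_integral_le_of_norm_le_const (μ := gauss n) (f := f)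
      (Eventually.of_forall habs)
  have hscale : ∀ c ∈ Set.Ioo (0 : ℝ) 1, ∀ x, (c * f x) ^ 2 < 1 := fun c hc x => by
    rw [mul_pow]
    nlinarith [hf1 x, hc.1, hc.2, _root_.sq_nonneg (f x)]
  have hmem : ∀ᶠ c in 𝓝[<] (1 : ℝ), c ∈ Set.Ioo (0 : ℝ) 1 :=
    Ioo_mem_nhdsLT zero_lt_one
  have hle : ∀ᶠ c in 𝓝[<] (1 : ℝ),
      ∫ x, bellman (c * f x) (c ^ 2 * ‖fderiv ℝ f x‖ ^ 2) ∂(gauss n) ≤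
        (c * ∫ x, f x ∂(gauss n)) * Real.arccos (-(c * ∫ x, f x ∂(gauss n)))
        + √(1 - (c * ∫ x, f x ∂(gauss n)) ^ 2) := by
    filter_upwards [hmem] with c hc
    have h := integral_bellman_le_of_abs_le (hf.const_mul c) hc.2 fun x => by
      rw [abs_mul, abs_of_pos hc.1]
      exact mul_le_of_le_one_right hc.1.le (habs x)
    have h2 : (c * ∫ x, f x ∂(gauss n)) ^ 2 < 1 := by
      rw [sq_lt_one_iff_abs_lt_one, abs_mul, abs_of_pos hc.1]
      exact (mul_le_of_le_one_right hc.1.le hm).trans_lt hc.2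
    rw [integral_const_mul, bellman_zero h2] at h
    refine le_of_eq_of_le (integral_congr_ae (Eventually.of_forall fun x => ?_)) h
    simp only [fderiv_const_mul (hf.differentiable x), norm_smul, mul_pow, norm_eq_abs, sq_abs]
  have hid : Tendsto (fun c : ℝ => c) (𝓝[<] 1) (𝓝 1) :=
    tendsto_nhdsWithin_of_tendsto_nhds tendsto_id
  have hright : Tendsto (fun c : ℝ => (c * ∫ x, f x ∂(gauss n))
      * Real.arccos (-(c * ∫ x, f x ∂(gauss n))) + √(1 - (c * ∫ x, f x ∂(gauss n)) ^ 2))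
      (𝓝[<] 1) (𝓝 ((∫ x, f x ∂(gauss n)) * Real.arccos (-∫ x, f x ∂(gauss n))
        + √(1 - (∫ x, f x ∂(gauss n)) ^ 2))) := by
    have hcont : Continuous fun t : ℝ => t * Real.arccos (-t) + √(1 - t ^ 2) := by
      have := Real.continuous_arccos
      fun_prop
    have h := hid.mul_const (∫ x, f x ∂(gauss n))
    rw [one_mul] at h
    exact (hcont.tendsto _).comp h
  refine le_of_tendsto_of_tendsto ?_ hright hle
  refine tendsto_integral_filter_of_dominated_convergence
    (fun _ => π + (1 + (1 + K ^ 2)) * Real.exp (1 + K ^ 2)) ?_ ?_ (integrable_const _) ?_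
  · filter_upwards [hmem] with c hc
    refine (continuous_iff_continuousAt.2 fun x => ?_).aestronglyMeasurable
    exact tendsto_bellman (hscale c hc x) (by positivity)
      (continuous_const.mul hf.continuous).continuousAt
      (continuous_const.mul (hf.continuous_fderiv.norm.pow 2)).continuousAt
      (Eventually.of_forall fun y => by positivity)
  · filter_upwards [hmem] with c hc
    refine Eventually.of_forall fun x => abs_bellman_le (hscale c hc x) (by positivity) ?_
    have h1 : c ^ 2 ≤ 1 := pow_le_one₀ hc.1.le hc.2.le
    exact (mul_le_of_le_one_left (by positivity) h1).trans (by gcongr; exact hK x)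
  · refine Eventually.of_forall fun x => tendsto_bellman (hf1 x) (by positivity) ?_ ?_
      (Eventually.of_forall fun y => by positivity)
    · simpa using hid.mul_const (f x)
    · simpa using (hid.pow 2).mul_const (‖fderiv ℝ f x‖ ^ 2)

end GaussianArccos

/-- the `arccos` isoperimetric inequality obtained by the EDS method:
for the standard Gaussian measure `γ` on `ℝⁿ`, a smooth bounded `f : ℝⁿ → (−1,1)`
with bounded derivatives, and `r : ℝⁿ → [0,∞)` determined pointwise by
`‖∇f‖² = r(e^r − f²)` (with `r > 0` where `∇f ≠ 0` and `r = 0` where `∇f = 0`),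
`∫ [f·arccos(−f e^{−r/2}) + (1−r)√(e^r − f²)] dγ
  ≤ (∫ f dγ)·arccos(−∫ f dγ) + √(1 − (∫ f dγ)²)`. -/
theorem stmt_19 (n : ℕ) (γ : Measure (EuclideanSpace ℝ (Fin n)))
    (hγ : γ = volume.withDensity
      (fun x => ENNReal.ofReal ((2 * π) ^ (-(n : ℝ) / 2) * Real.exp (-‖x‖ ^ 2 / 2))))
    (f : EuclideanSpace ℝ (Fin n) → ℝ)
    (hf : ContDiff ℝ (⊤ : ℕ∞) f)
    (hrange : ∀ x, f x ∈ Set.Ioo (-1 : ℝ) 1)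
    (hfd : ∀ i : ℕ, ∃ C : ℝ, ∀ x, ‖iteratedFDeriv ℝ i f x‖ ≤ C)
    (r : EuclideanSpace ℝ (Fin n) → ℝ)
    (hr0 : ∀ x, 0 ≤ r x)
    (hreq : ∀ x, ‖fderiv ℝ f x‖ ^ 2 = r x * (Real.exp (r x) - (f x) ^ 2))
    (hrpos : ∀ x, fderiv ℝ f x ≠ 0 → 0 < r x)
    (hrzero : ∀ x, fderiv ℝ f x = 0 → r x = 0) :
    ∫ x, (f x * Real.arccos (-(f x) * Real.exp (-(r x) / 2))
        + (1 - r x) * Real.sqrt (Real.exp (r x) - (f x) ^ 2)) ∂γ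
      ≤ (∫ x, f x ∂γ) * Real.arccos (-(∫ x, f x ∂γ))
        + Real.sqrt (1 - (∫ x, f x ∂γ) ^ 2) := by
  have hf1 : ∀ x, f x ^ 2 < 1 := fun x =>
    (sq_lt_one_iff_abs_lt_one _).2 (abs_lt.2 (hrange x))
  have h := GaussianArccos.integral_bellman_le ⟨hf, hfd⟩ hf1
  simp only [GaussianArccos.bellman,
    fun x => GaussianArccos.root_unique (hf1 x) (hr0 x) (hreq x).symm] at h
  rw [hγ]
  exact h
end
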